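/- Let H be an ordered graph on h vertices with interval chromatic number χ<(H)=2 such that H has Property A, H does not have Property B, and neither the vertex 1 nor the vertex h has Property C. For every η>0 there exists n₀∈ℕ such that every ordered graph G on n ≥ n₀ vertices with n divisible by h and minimum degree δ(G) ≥ (1 − α*(H) + η)n contains a perfect H-tiling. -/

import Mathlib

open Finset

section Defs

variable {h n : ℕ}

/-- `φ` is an order-preserving embedding of the ordered graph `H` into the ordered graph `G`:
a strictly increasing map carrying edges of `H` to edges of `G`. -/
def IsOrderedCopy (H : SimpleGraph (Fin h)) (G : SimpleGraph (Fin n))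
    (φ : Fin h → Fin n) : Prop :=
  StrictMono φ ∧ ∀ i j : Fin h, H.Adj i j → G.Adj (φ i) (φ j)

/-- `S` is the vertex set of a copy of the ordered graph `H` in the ordered graph `G`. -/
def IsCopySet (H : SimpleGraph (Fin h)) (G : SimpleGraph (Fin n))
    (S : Finset (Fin n)) : Prop :=
  ∃ φ : Fin h → Fin n, IsOrderedCopy H G φ ∧ Finset.image φ Finset.univ = S

/-- `G` has an `H`-tiling (vertex-disjoint copies of `H`) whose copies exactly cover the
vertex set `S`; equivalently, the induced ordered subgraph `G[S]` has a perfect `H`-tiling. -/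
def HasPerfectTilingOn (H : SimpleGraph (Fin h)) (G : SimpleGraph (Fin n))
    (S : Finset (Fin n)) : Prop :=
  ∃ 𝒯 : Finset (Finset (Fin n)),
    (∀ T ∈ 𝒯, IsCopySet H G T) ∧
    (𝒯 : Set (Finset (Fin n))).PairwiseDisjoint id ∧
    𝒯.biUnion id = S

/-- `G` has a perfect `H`-tiling. -/
def HasPerfectTiling (H : SimpleGraph (Fin h)) (G : SimpleGraph (Fin n)) : Prop :=
  HasPerfectTilingOn H G Finset.univ

/-- The degree of a vertex in an ordered graph. -/
noncomputable def odeg (G : SimpleGraph (Fin n)) (v : Fin n) : ℕ :=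
  (G.neighborSet v).ncard

/-- `[h]` can be partitioned into `k` intervals, each independent in `H`
(expressed via a monotone colouring with independent fibres). -/
def HasIntervalColoring (H : SimpleGraph (Fin h)) (k : ℕ) : Prop :=
  ∃ c : Fin h → Fin k, Monotone c ∧ ∀ i j : Fin h, H.Adj i j → c i ≠ c j

/-- The interval chromatic number `χ<(H)` of an ordered graph. -/
noncomputable def intervalChi (H : SimpleGraph (Fin h)) : ℕ :=
  sInf {k | HasIntervalColoring H k}

/-- `α⁺ᵢ(H)`: `α⁺₀ = 0`, and `α⁺_{i+1}` is the largest `k ≤ h` such that the interval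
`[α⁺ᵢ + 1, k]` is independent in `H` (vertices are 1-indexed via `v ↦ (v : ℕ) + 1`). -/
noncomputable def alphaPlus (H : SimpleGraph (Fin h)) : ℕ → ℕ
  | 0 => 0
  | (i + 1) => sSup {k | k ≤ h ∧ ∀ a b : Fin h,
      alphaPlus H i + 1 ≤ (a : ℕ) + 1 → (a : ℕ) + 1 ≤ k →
      alphaPlus H i + 1 ≤ (b : ℕ) + 1 → (b : ℕ) + 1 ≤ k → ¬ H.Adj a b}

/-- `α⁻ᵢ(H)`: `α⁻₀ = h + 1`, and `α⁻_{i+1}` is the smallest `k ≥ 1` such that the interval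
`[k, α⁻ᵢ − 1]` is independent in `H`. -/
noncomputable def alphaMinus (H : SimpleGraph (Fin h)) : ℕ → ℕ
  | 0 => h + 1
  | (i + 1) => sInf {k | 1 ≤ k ∧ ∀ a b : Fin h,
      k ≤ (a : ℕ) + 1 → (a : ℕ) + 1 ≤ alphaMinus H i - 1 →
      k ≤ (b : ℕ) + 1 → (b : ℕ) + 1 ≤ alphaMinus H i - 1 → ¬ H.Adj a b}

/-- `α*(H) = min over 1 ≤ ℓ < χ<(H) of min{α⁺_ℓ/(ℓh), (h − α⁻_ℓ + 1)/(ℓh)}`. -/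
noncomputable def alphaStar (H : SimpleGraph (Fin h)) : ℝ :=
  sInf {x : ℝ | ∃ ℓ : ℕ, 1 ≤ ℓ ∧ ℓ < intervalChi H ∧
    (x = (alphaPlus H ℓ : ℝ) / (ℓ * h) ∨
     x = ((h : ℝ) - alphaMinus H ℓ + 1) / (ℓ * h))}

/-- `α*(H)` for ordered graphs with interval chromatic number 2:
`min{α⁺₁(H)/h, (h − α⁻₁(H) + 1)/h}`. -/
noncomputable def alphaStar2 (H : SimpleGraph (Fin h)) : ℝ :=
  min ((alphaPlus H 1 : ℝ) / h) (((h : ℝ) - alphaMinus H 1 + 1) / h)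

/-- Property A: no edges of `H` within `[1, ⌊h/2⌋ + 1]` nor within `[⌈h/2⌉, h]`. -/
def PropertyA (H : SimpleGraph (Fin h)) : Prop :=
  (∀ a b : Fin h, (a : ℕ) + 1 ≤ h / 2 + 1 → (b : ℕ) + 1 ≤ h / 2 + 1 → ¬ H.Adj a b) ∧
  (∀ a b : Fin h, (h + 1) / 2 ≤ (a : ℕ) + 1 → (h + 1) / 2 ≤ (b : ℕ) + 1 → ¬ H.Adj a b)

/-- Property B: for each partition of `[h]` into nonempty intervals `[1, i], [i+1, h]`
there is an edge of `H` between them. -/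
def PropertyB (H : SimpleGraph (Fin h)) : Prop :=
  ∀ i : ℕ, 1 ≤ i → i < h →
    ∃ a b : Fin h, H.Adj a b ∧ (a : ℕ) + 1 ≤ i ∧ i + 1 ≤ (b : ℕ) + 1

/-- `s(H)`: the smallest vertex adjacent to `h`, and `0` if `h` is isolated. -/
noncomputable def sOG (H : SimpleGraph (Fin h)) : ℕ :=
  sInf {k | ∃ a b : Fin h, H.Adj a b ∧ (a : ℕ) + 1 = k ∧ (b : ℕ) + 1 = h}

open Classical in
/-- `l(H)`: the largest vertex adjacent to `1`, and `h + 1` if `1` is isolated. -/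
noncomputable def lOG (H : SimpleGraph (Fin h)) : ℕ :=
  if ∃ a b : Fin h, H.Adj a b ∧ (a : ℕ) + 1 = 1 then
    sSup {k | ∃ a b : Fin h, H.Adj a b ∧ (a : ℕ) + 1 = 1 ∧ (b : ℕ) + 1 = k}
  else h + 1

/-- The vertex `h` has Property C: `s(H) ≥ 1` and there is an edge within `[s(H), h − 1]`. -/
def PropertyCLast (H : SimpleGraph (Fin h)) : Prop :=
  1 ≤ sOG H ∧ ∃ a b : Fin h, H.Adj a b ∧
    sOG H ≤ (a : ℕ) + 1 ∧ (a : ℕ) + 1 ≤ h - 1 ∧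
    sOG H ≤ (b : ℕ) + 1 ∧ (b : ℕ) + 1 ≤ h - 1

/-- The vertex `1` has Property C: `l(H) ≤ h` and there is an edge within `[2, l(H)]`. -/
def PropertyCFirst (H : SimpleGraph (Fin h)) : Prop :=
  lOG H ≤ h ∧ ∃ a b : Fin h, H.Adj a b ∧
    2 ≤ (a : ℕ) + 1 ∧ (a : ℕ) + 1 ≤ lOG H ∧
    2 ≤ (b : ℕ) + 1 ∧ (b : ℕ) + 1 ≤ lOG H

/-- `S` is an `H`-absorbing set for `W`: both `G[S]` and `G[S ∪ W]` have perfect `H`-tilings. -/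
def IsAbsorbingFor (H : SimpleGraph (Fin h)) (G : SimpleGraph (Fin n))
    (S W : Finset (Fin n)) : Prop :=
  HasPerfectTilingOn H G S ∧ HasPerfectTilingOn H G (S ∪ W)

end Defs

section Regularity

/-- The density `d(A,B) = e(A,B)/(|A||B|)` of a pair of vertex sets in a graph. -/
noncomputable def pairDensity {V : Type*} (G : SimpleGraph V) (A B : Finset V) : ℝ :=
  ({e : V × V | e.1 ∈ A ∧ e.2 ∈ B ∧ G.Adj e.1 e.2}.ncard : ℝ) /
    ((A.card : ℝ) * (B.card : ℝ))

/-- The pair `(A, B)` is `ε`-regular in `G`. -/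
def IsRegularPair {V : Type*} (G : SimpleGraph V) (A B : Finset V) (ε : ℝ) : Prop :=
  ∀ X ⊆ A, ∀ Y ⊆ B, ε * A.card ≤ (X.card : ℝ) → ε * B.card ≤ (Y.card : ℝ) →
    |pairDensity G A B - pairDensity G X Y| < ε

end Regularity

section Bottle

/-- The chromatic number of a finite graph. -/
noncomputable def chromNum {m : ℕ} (B : SimpleGraph (Fin m)) : ℕ :=
  sInf {k | ∃ c : Fin m → Fin k, ∀ x y : Fin m, B.Adj x y → c x ≠ c y}

/-- `σ(B)`: the smallest size of a colour class in any proper colouring of `B`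
with `χ(B)` colours. -/
noncomputable def sigmaMinCl {m : ℕ} (B : SimpleGraph (Fin m)) : ℕ :=
  sInf {c | ∃ C : Fin m → Fin (chromNum B),
    (∀ x y : Fin m, B.Adj x y → C x ≠ C y) ∧
    ∃ i : Fin (chromNum B), c = (Finset.univ.filter (fun v => C v = i)).card}

/-- The critical chromatic number `χ_cr(B) = (χ(B) − 1)·|B|/(|B| − σ(B))`. -/
noncomputable def critChrom {m : ℕ} (B : SimpleGraph (Fin m)) : ℝ :=
  ((chromNum B : ℝ) - 1) * m / ((m : ℝ) - sigmaMinCl B)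

/-- `φ` is an interval labeling of the complete multipartite graph with part function `p`
(with respect to some permutation `σ` of the parts). -/
def IsIntervalLabeling {m k : ℕ} (p : Fin m → Fin k) (φ : Equiv.Perm (Fin m)) : Prop :=
  ∃ σ : Equiv.Perm (Fin k), ∀ x y : Fin m, σ (p x) < σ (p y) → φ x < φ y

/-- `G` is (an isomorphic realisation of) the ordered blow-up `(B(t), φ)` of the complete
multipartite graph `B` with part function `p`: there is a block assignment `β` whose fibres
all have size `t`, compatible with the order induced by `φ`, with adjacency between blocks
given by `B`. -/
def IsOrderedBlowup {m k : ℕ} (p : Fin m → Fin k) (φ : Equiv.Perm (Fin m)) (t : ℕ)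
    {N : ℕ} (G : SimpleGraph (Fin N)) : Prop :=
  ∃ β : Fin N → Fin m,
    (∀ x : Fin m, {u : Fin N | β u = x}.ncard = t) ∧
    (∀ u v : Fin N, u ≤ v → φ (β u) ≤ φ (β v)) ∧
    (∀ u v : Fin N, G.Adj u v ↔ p (β u) ≠ p (β v))

/-- The complete multipartite graph with part function `p` is a bottlegraph assigned to `H`:
for every interval labeling `φ` there is a `t ≥ 1` such that the ordered blow-up `(B(t), φ)`
has a perfect `H`-tiling. -/
def IsBottlegraph {h m k : ℕ} (H : SimpleGraph (Fin h)) (p : Fin m → Fin k) : Prop :=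
  ∀ φ : Equiv.Perm (Fin m), IsIntervalLabeling p φ →
    ∃ t : ℕ, 0 < t ∧ ∀ (N : ℕ) (G : SimpleGraph (Fin N)),
      IsOrderedBlowup p φ t G → HasPerfectTiling H G

end Bottle

section Tiling

variable {h n : ℕ} {H : SimpleGraph (Fin h)} {G : SimpleGraph (Fin n)}

lemma HasPerfectTilingOn.empty : HasPerfectTilingOn H G ∅ :=
  ⟨∅, by simp, by simp, by simp⟩

lemma IsCopySet.hasPerfectTilingOn {S : Finset (Fin n)} (hS : IsCopySet H G S) :
    HasPerfectTilingOn H G S :=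
  ⟨{S}, by simpa using hS, by simp, by simp⟩

lemma HasPerfectTilingOn.union {S T : Finset (Fin n)} (hS : HasPerfectTilingOn H G S)
    (hT : HasPerfectTilingOn H G T) (hST : Disjoint S T) : HasPerfectTilingOn H G (S ∪ T) := by
  obtain ⟨𝒮, hS₁, hS₂, rfl⟩ := hS
  obtain ⟨𝒯, hT₁, hT₂, rfl⟩ := hT
  refine ⟨𝒮 ∪ 𝒯, ?_, ?_, Finset.union_biUnion⟩
  · intro T hT
    rcases Finset.mem_union.1 hT with h | h
    exacts [hS₁ T h, hT₁ T h]
  · rw [Finset.coe_union]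
    refine hS₂.union hT₂ fun A hA B hB _ ↦ hST.mono ?_ ?_
    · exact Finset.subset_biUnion_of_mem id hA
    · exact Finset.subset_biUnion_of_mem id hB

lemma orderEmbOfFin_mem_iff {S D : Finset (Fin n)} (hS : #S = h) (hDS : D ⊆ S)
    (hD : ∀ s ∈ S, ∀ d ∈ D, s ≤ d → s ∈ D) (i : Fin h) :
    S.orderEmbOfFin hS i ∈ D ↔ (i : ℕ) < #D := by
  set φ := S.orderEmbOfFin hS
  have hφ : ∀ s ∈ S, ∃ j, φ j = s := fun s hs ↦ by
    have : s ∈ Set.range φ := by rw [Finset.range_orderEmbOfFin]; exact hs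
    exact this
  constructor
  · intro hi
    have : (Finset.Iic i).map φ.toEmbedding ⊆ D := by
      intro s hs
      obtain ⟨j, hj, rfl⟩ := Finset.mem_map.1 hs
      exact hD _ (Finset.orderEmbOfFin_mem ..) _ hi (φ.monotone (Finset.mem_Iic.1 hj))
    have := Finset.card_le_card this
    rw [Finset.card_map, Fin.card_Iic] at this
    omega
  · intro hi
    by_contra hcon
    have : D ⊆ (Finset.Iio i).map φ.toEmbedding := by
      intro d hd
      obtain ⟨j, rfl⟩ := hφ d (hDS hd)
      refine Finset.mem_map.2 ⟨j, Finset.mem_Iio.2 (lt_of_not_ge fun hij ↦ hcon ?_), rfl⟩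
      exact hD _ (Finset.orderEmbOfFin_mem ..) _ hd (φ.monotone hij)
    have := Finset.card_le_card this
    rw [Finset.card_map, Fin.card_Iio] at this
    omega

/-- Three consecutive vertex sets of total size `h` span a copy of `H` as soon as all pairs of
parts joined by an edge of `H` are complete to each other. -/
lemma isCopySet_of_parts {D₁ D₂ D₃ : Finset (Fin n)}
    (h₁₂ : ∀ u ∈ D₁, ∀ v ∈ D₂, u < v) (h₁₃ : ∀ u ∈ D₁, ∀ v ∈ D₃, u < v)
    (h₂₃ : ∀ u ∈ D₂, ∀ v ∈ D₃, u < v) (hcard : #D₁ + #D₂ + #D₃ = h)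
    (hadj : ∀ i j : Fin h, i < j → H.Adj i j →
      ∀ u ∈ (if (i : ℕ) < #D₁ then D₁ else if (i : ℕ) < #D₁ + #D₂ then D₂ else D₃),
      ∀ v ∈ (if (j : ℕ) < #D₁ then D₁ else if (j : ℕ) < #D₁ + #D₂ then D₂ else D₃),
        G.Adj u v) :
    IsCopySet H G (D₁ ∪ D₂ ∪ D₃) := by
  have d₁₂ : Disjoint D₁ D₂ :=
    Finset.disjoint_left.2 fun u hu hv ↦ lt_irrefl _ (h₁₂ u hu u hv)
  have d₃ : Disjoint (D₁ ∪ D₂) D₃ := by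
    refine Finset.disjoint_left.2 fun u hu hv ↦ ?_
    rcases Finset.mem_union.1 hu with hu | hu
    exacts [lt_irrefl _ (h₁₃ u hu u hv), lt_irrefl _ (h₂₃ u hu u hv)]
  have hS : #(D₁ ∪ D₂ ∪ D₃) = h := by
    rw [Finset.card_union_of_disjoint d₃, Finset.card_union_of_disjoint d₁₂, hcard]
  have key₁ := orderEmbOfFin_mem_iff (D := D₁) hS (by grind) (by grind)
  have key₂ := orderEmbOfFin_mem_iff (D := D₁ ∪ D₂) hS (by grind) (by grind)
  rw [Finset.card_union_of_disjoint d₁₂] at key₂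
  set φ := (D₁ ∪ D₂ ∪ D₃).orderEmbOfFin hS with hφ
  have mem (i : Fin h) :
      φ i ∈ (if (i : ℕ) < #D₁ then D₁ else if (i : ℕ) < #D₁ + #D₂ then D₂ else D₃) := by
    have h0 : φ i ∈ D₁ ∪ D₂ ∪ D₃ := Finset.orderEmbOfFin_mem ..
    have h1 := key₁ i
    have h2 := key₂ i
    grind
  refine ⟨φ, ⟨φ.strictMono, fun i j hij ↦ ?_⟩, ?_⟩
  · rcases lt_or_gt_of_ne hij.ne with hlt | hlt
    · exact hadj i j hlt hij _ (mem i) _ (mem j)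
    · exact (hadj j i hlt hij.symm _ (mem j) _ (mem i)).symm
  · exact Finset.coe_injective (by simp [hφ])

/-- `H` splits with margins `g ≤ r`: every edge of `H` starts among the first `g` vertices and ends
after the first `r` ones, where `g + r = h` and `g < r`. -/
structure IsSplit (H : SimpleGraph (Fin h)) (g r : ℕ) : Prop where
  add_eq : g + r = h
  lt : g < r
  edge : ∀ a b : Fin h, a < b → H.Adj a b → (a : ℕ) < g ∧ r ≤ (b : ℕ)

/-- All vertices of `A` precede all vertices of `B` and are adjacent to them. -/
def CompletePair (G : SimpleGraph (Fin n)) (A B : Finset (Fin n)) : Prop :=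
  ∀ a ∈ A, ∀ b ∈ B, a < b ∧ G.Adj a b

lemma CompletePair.mono {A B A' B' : Finset (Fin n)} (hAB : CompletePair G A B) (hA : A' ⊆ A)
    (hB : B' ⊆ B) : CompletePair G A' B' :=
  fun a ha b hb ↦ hAB a (hA ha) b (hB hb)

lemma CompletePair.disjoint {A B : Finset (Fin n)} (hAB : CompletePair G A B) : Disjoint A B :=
  Finset.disjoint_left.2 fun u hu hv ↦ lt_irrefl _ (hAB u hu u hv).1

variable {g r : ℕ}

lemma CompletePair.isCopySet (hH : IsSplit H g r) {A B : Finset (Fin n)}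
    (hAB : CompletePair G A B) (hcard : #A + #B = h) (hg : g ≤ #A) (hr : #A ≤ r) :
    IsCopySet H G (A ∪ B) := by
  have := isCopySet_of_parts (H := H) (G := G) (D₁ := A) (D₂ := ∅) (D₃ := B) (by simp)
    (fun u hu v hv ↦ (hAB u hu v hv).1) (by simp) (by simpa using hcard) (by
      intro i j hij hadj u hu v hv
      have := hH.edge i j hij hadj
      have := hAB u
      grind)
  simpa using this

lemma CompletePair.hasPerfectTilingOn (hH : IsSplit H g r) (T : ℕ) :
    ∀ {A B : Finset (Fin n)}, CompletePair G A B → #A + #B = T * h → T * g ≤ #A → #A ≤ T * r →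
      HasPerfectTilingOn H G (A ∪ B) := by
  have hgr := hH.add_eq
  have hlt := hH.lt
  induction T with
  | zero =>
    intro A B _ hcard _ _
    have hA : A = ∅ := Finset.card_eq_zero.1 (by omega)
    have hB : B = ∅ := Finset.card_eq_zero.1 (by omega)
    subst hA hB
    exact .empty
  | succ T ih =>
    intro A B hAB hcard hg hr
    have e : T * h = T * g + T * r := by rw [← hgr]; ring
    have le : T * g ≤ T * r := Nat.mul_le_mul_left _ hlt.le
    rw [Nat.succ_mul] at hcard hg hr
    set c := max g (#A - T * r) with hc
    obtain ⟨A', hA', cA⟩ := Finset.exists_subset_card_eq (s := A) (n := c) (by omega)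
    obtain ⟨B', hB', cB⟩ := Finset.exists_subset_card_eq (s := B) (n := h - c) (by omega)
    have dA := Finset.card_sdiff_of_subset hA'
    have dB := Finset.card_sdiff_of_subset hB'
    have h1 := (hAB.mono hA' hB').isCopySet hH (by omega) (by omega) (by omega)
    have h2 := ih (hAB.mono (A' := A \ A') (B' := B \ B') (by grind) (by grind))
      (by omega) (by omega) (by omega)
    have hd := Finset.disjoint_left.1 hAB.disjoint
    have : A ∪ B = (A' ∪ B') ∪ (A \ A' ∪ B \ B') := by grind
    rw [this]
    exact h1.hasPerfectTilingOn.union h2 (by rw [Finset.disjoint_left]; grind)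

lemma CompletePair.isCopySet_insert (hH : IsSplit H g r)
    (h₀ : ∀ a b : Fin h, (a : ℕ) = 0 → ¬ H.Adj a b) {A B : Finset (Fin n)}
    (hAB : CompletePair G A B) {z : Fin n} (hzA : ∀ a ∈ A, z < a) (hzB : ∀ b ∈ B, z < b)
    (cA : #A + 1 = r) (cB : #B = g) :
    IsCopySet H G (insert z (A ∪ B)) := by
  have hgr := hH.add_eq
  have := isCopySet_of_parts (H := H) (G := G) (D₁ := {z}) (D₂ := A) (D₃ := B) (by simpa)
    (by simpa) (fun u hu v hv ↦ (hAB u hu v hv).1) (by simp; omega) (by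
      intro i j hij hadj u hu v hv
      have h1 := hH.edge i j hij hadj
      have h2 : (i : ℕ) ≠ 0 := fun h ↦ h₀ i j h hadj
      have := hAB u
      have := hH.lt
      have h3 : ¬ (i : ℕ) < 1 := by omega
      have h4 : (i : ℕ) < 1 + #A := by omega
      have h5 : ¬ (j : ℕ) < 1 := by omega
      have h6 : ¬ (j : ℕ) < 1 + #A := by omega
      simp only [Finset.card_singleton, h3, h4, h5, h6, if_true, if_false] at hu hv
      exact (hAB u hu v hv).2)
  rwa [Finset.union_assoc, ← Finset.insert_eq] at this

lemma CompletePair.hasPerfectTilingOn_union (hH : IsSplit H g r)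
    (h₀ : ∀ a b : Fin h, (a : ℕ) = 0 → ¬ H.Adj a b) {T a b : ℕ} (hcard : a + b = T * h)
    (hga : T * g ≤ a) (har : a ≤ T * r) (Z : Finset (Fin n)) :
    ∀ {A B : Finset (Fin n)}, CompletePair G A B → (∀ z ∈ Z, ∀ v ∈ A ∪ B, z < v) →
      #A = #Z * (r - 1) + a → #B = #Z * g + b → HasPerfectTilingOn H G (Z ∪ (A ∪ B)) := by
  have hlt := hH.lt
  induction Z using Finset.induction_on with
  | empty =>
    intro A B hAB _ cA cB
    simp only [Finset.card_empty, zero_mul, zero_add] at cA cB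
    rw [Finset.empty_union]
    exact hAB.hasPerfectTilingOn hH T (by omega) (by omega) (by omega)
  | insert z Z hz ih =>
    intro A B hAB hZ cA cB
    rw [Finset.card_insert_of_notMem hz, Nat.succ_mul] at cA cB
    obtain ⟨A', hA', cA'⟩ := Finset.exists_subset_card_eq (s := A) (n := r - 1) (by omega)
    obtain ⟨B', hB', cB'⟩ := Finset.exists_subset_card_eq (s := B) (n := g) (by omega)
    have dA := Finset.card_sdiff_of_subset hA'
    have dB := Finset.card_sdiff_of_subset hB'
    have h1 := (hAB.mono hA' hB').isCopySet_insert hH h₀ (z := z)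
      (fun a ha ↦ hZ z (by simp) a (by grind)) (fun a ha ↦ hZ z (by simp) a (by grind))
      (by omega) cB'
    have h2 := ih (hAB.mono (A' := A \ A') (B' := B \ B') (by grind) (by grind))
      (fun w hw v hv ↦ hZ w (by simp [hw]) v (by grind)) (by omega) (by omega)
    have hd := Finset.disjoint_left.1 hAB.disjoint
    have hzd : ∀ w ∈ insert z Z, w ∉ A ∪ B := fun w hw hw' ↦ lt_irrefl _ (hZ w hw w hw')
    have : insert z Z ∪ (A ∪ B) = insert z (A' ∪ B') ∪ (Z ∪ (A \ A' ∪ B \ B')) := by grind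
    rw [this]
    refine h1.hasPerfectTilingOn.union h2 (Finset.disjoint_left.2 fun v hv hv' ↦ ?_)
    have hvz : v = z → v ∉ Z ∧ v ∉ A ∧ v ∉ B := fun h ↦ by
      have := hzd z (by simp)
      subst h
      simp_all
    have hvZ : v ∈ Z → v ∉ A ∧ v ∉ B := fun h ↦ by
      have := hzd v (by simp [h])
      simpa using this
    have hvA := @hA' v
    have hvB := @hB' v
    have hvd := @hd v
    simp only [Finset.mem_insert, Finset.mem_union, Finset.mem_sdiff] at hv hv'
    tauto

/-- The pair `(A, B)` contains `h - 1` vertices which form a copy of `H` together with `x`. -/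
def CompletesTo (H : SimpleGraph (Fin h)) (G : SimpleGraph (Fin n)) (x : Fin n)
    (A B : Finset (Fin n)) : Prop :=
  ∃ C ⊆ A ∪ B, #C + 1 = h ∧ IsCopySet H G (insert x C)

lemma CompletePair.hasPerfectTilingOn_gadget (hH : IsSplit H g r) {A B : Finset (Fin n)}
    (hAB : CompletePair G A B) (cA : #A = h ^ 3) (cB : #B = h ^ 3) :
    HasPerfectTilingOn H G (A ∪ B) := by
  have hgr := hH.add_eq
  have hlt := hH.lt
  refine hAB.hasPerfectTilingOn hH (2 * h ^ 2) (by rw [cA, cB]; ring) ?_ ?_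
  · rw [cA]; nlinarith [pow_pos (show 0 < h by omega) 2]
  · rw [cA]; nlinarith [pow_pos (show 0 < h by omega) 2]

lemma absorb_margin {q p k : ℕ} (hp : p ≤ q) (hk : k ≤ q) (hh : h = q + 1) :
    q * p + k ≤ h ^ 3 := by
  have := Nat.mul_le_mul_left q hp
  subst hh
  nlinarith [Nat.zero_le (q ^ 3), Nat.zero_le (q ^ 2)]

lemma absorb_lower {q p k g : ℤ} (hq : 0 ≤ q) (hg : 2 * g ≤ q) (hp : q * p ≤ q * q)
    (hk : k ≤ q) : (2 * (q + 1) ^ 2 - q) * g ≤ (q + 1) ^ 3 - (q * p + k) := by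
  have := mul_le_mul_of_nonneg_left hg (show 0 ≤ 2 * (q + 1) ^ 2 - q by nlinarith)
  linarith [sq_nonneg q]

lemma absorb_upper {q p k : ℤ} (hq : 0 ≤ q) (hp : q + 2 ≤ 2 * (p + 1)) (hk : 0 ≤ q * p + k) :
    (q + 1) ^ 3 - (q * p + k) ≤ (2 * (q + 1) ^ 2 - q) * (p + 1) := by
  have := mul_le_mul_of_nonneg_left hp (show 0 ≤ 2 * (q + 1) ^ 2 - q by nlinarith)
  linarith [sq_nonneg q]

lemma CompletePair.hasPerfectTilingOn_absorb (hH : IsSplit H g r)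
    (h₀ : ∀ a b : Fin h, (a : ℕ) = 0 → ¬ H.Adj a b) {A B Z : Finset (Fin n)} {x : Fin n}
    (hAB : CompletePair G A B) (cA : #A = h ^ 3) (cB : #B = h ^ 3) (cZ : #Z + 1 = h)
    (hZ : ∀ z ∈ Z, ∀ v ∈ A ∪ B, z < v) (hxAB : x ∉ A ∪ B) (hxZ : x ∉ Z)
    (hx : CompletesTo H G x A B) : HasPerfectTilingOn H G (A ∪ B ∪ insert x Z) := by
  have hgr := hH.add_eq
  have hlt := hH.lt
  obtain ⟨C, hC, cC, hcopy⟩ := hx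
  have hd := Finset.disjoint_left.1 hAB.disjoint
  have hzd : ∀ w ∈ Z, w ∉ A ∪ B := fun w hw hw' ↦ lt_irrefl _ (hZ w hw w hw')
  have e₁ := Finset.card_inter_add_card_sdiff A C
  have e₂ := Finset.card_inter_add_card_sdiff B C
  have e₃ : #(A ∩ C) + #(B ∩ C) = #C := by
    rw [← Finset.card_union_of_disjoint (by rw [Finset.disjoint_left]; grind)]
    congr 1
    grind
  obtain ⟨p, rfl⟩ : ∃ p, r = p + 1 := ⟨r - 1, by omega⟩
  have hz : #Z = g + p := by omega
  have hh : h = g + p + 1 := by omega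
  have i1 : (g + p) * p + #(A ∩ C) ≤ h ^ 3 := absorb_margin (by omega) (by omega) hh
  have i2 : (g + p) * g + #(B ∩ C) ≤ h ^ 3 := absorb_margin (by omega) (by omega) hh
  have i3 : g + p ≤ 2 * h ^ 2 := by linarith [Nat.le_self_pow two_ne_zero h]
  have main : HasPerfectTilingOn H G (Z ∪ (A \ C ∪ B \ C)) := by
    refine CompletePair.hasPerfectTilingOn_union hH h₀
      (T := 2 * h ^ 2 - (g + p)) (a := h ^ 3 - ((g + p) * p + #(A ∩ C)))
      (b := h ^ 3 - ((g + p) * g + #(B ∩ C))) ?_ ?_ ?_ Z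
      (hAB.mono (by grind) (by grind)) (fun z hz v hv ↦ hZ z hz v (by grind)) ?_ ?_
    · zify [i1, i2, i3]
      have : (#(B ∩ C) : ℤ) = g + p - #(A ∩ C) := by omega
      rw [this, hh]
      push_cast
      ring
    · have h3 : #(A ∩ C) ≤ g + p := by omega
      have h4 : 2 * g ≤ g + p := by omega
      have h5 : (g + p) * p ≤ (g + p) * (g + p) := Nat.mul_le_mul_left _ (by omega)
      zify [i1, i3] at h3 h4 h5 ⊢
      have hz : (h : ℤ) = (g + p : ℤ) + 1 := by omega
      rw [hz]
      generalize (g + p : ℤ) = q at *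
      exact absorb_lower (by linarith) h4 h5 h3
    · have h4 : g + p + 2 ≤ 2 * (p + 1) := by omega
      have h5 : 0 ≤ (g + p) * p + #(A ∩ C) := by omega
      zify [i1, i3] at h4 h5 ⊢
      have hz : (h : ℤ) = (g + p : ℤ) + 1 := by omega
      rw [hz]
      have hq : 0 ≤ (g : ℤ) + p := by positivity
      generalize (g + p : ℤ) = q at *
      exact absorb_upper hq h4 h5
    · rw [hz]; simp only [Nat.add_sub_cancel]; omega
    · rw [hz]; omega
  have : A ∪ B ∪ insert x Z = insert x C ∪ (Z ∪ (A \ C ∪ B \ C)) := by grind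
  rw [this]
  exact hcopy.hasPerfectTilingOn.union main (by rw [Finset.disjoint_left]; grind)

end Tiling

section Absorb

variable {h n : ℕ} {H : SimpleGraph (Fin h)} {G : SimpleGraph (Fin n)} {g r : ℕ}

/-- The vertex `x` can be added to a subset of the complete pair `(A, B)` to form a copy of a graph
with margins `g < r`. -/
def Fits (G : SimpleGraph (Fin n)) (x : Fin n) (A B : Finset (Fin n)) : Prop :=
  (∀ b ∈ B, b < x ∧ G.Adj b x) ∨ (∀ a ∈ A, ∀ b ∈ B, b < x ∧ G.Adj a x) ∨
    (∀ a ∈ A, ∀ b ∈ B, a < x ∧ x < b) ∨ ∀ a ∈ A, x < a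

/-- There is a cut point `k` which separates the ends of every edge avoiding the last vertex, and
which precedes all neighbours of the last vertex. -/
def LastCut (H : SimpleGraph (Fin h)) : Prop :=
  ∃ k, k + 1 ≤ h ∧ ∀ a b : Fin h, a < b → H.Adj a b →
    ((b : ℕ) + 1 ≠ h → (a : ℕ) < k ∧ k ≤ (b : ℕ)) ∧ ((b : ℕ) + 1 = h → k ≤ (a : ℕ))

lemma CompletePair.completesTo (hH : IsSplit H g r)
    (h₀ : ∀ a b : Fin h, (a : ℕ) = 0 → ¬ H.Adj a b) (hL : LastCut H) {A B : Finset (Fin n)}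
    {x : Fin n} (hAB : CompletePair G A B) (cA : h ≤ #A) (cB : h ≤ #B) (hx : Fits G x A B) :
    CompletesTo H G x A B := by
  have hgr := hH.add_eq
  have hlt := hH.lt
  obtain ⟨a₀, ha₀⟩ : A.Nonempty := Finset.card_pos.1 (by omega)
  obtain ⟨b₀, hb₀⟩ : B.Nonempty := Finset.card_pos.1 (by omega)
  have hd := hAB.disjoint
  have sub {i j : ℕ} (hi : i + j + 1 = h) : ∃ C ⊆ A, ∃ D ⊆ B, #C = i ∧ #D = j ∧
      #(C ∪ D) + 1 = h ∧ C ∪ D ⊆ A ∪ B ∧ CompletePair G C D := by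
    obtain ⟨C, hC, cC⟩ := Finset.exists_subset_card_eq (s := A) (n := i) (by omega)
    obtain ⟨D, hD, cD⟩ := Finset.exists_subset_card_eq (s := B) (n := j) (by omega)
    refine ⟨C, hC, D, hD, cC, cD, ?_, Finset.union_subset_union hC hD, hAB.mono hC hD⟩
    rw [Finset.card_union_of_disjoint (hd.mono hC hD)]
    omega
  rcases hx with hx | hx | hx | hx
  · obtain ⟨k, hk, hcut⟩ := hL
    obtain ⟨C, hC, D, hD, cC, cD, hcard, hsub, hCD⟩ := sub (i := k) (j := h - 1 - k) (by omega)
    refine ⟨C ∪ D, hsub, hcard, ?_⟩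
    have := isCopySet_of_parts (H := H) (G := G) (D₁ := C) (D₂ := D) (D₃ := {x})
      (fun u hu v hv ↦ (hCD u hu v hv).1)
      (fun u hu v hv ↦ by
        rw [Finset.mem_singleton.1 hv]
        exact (hAB u (hC hu) b₀ hb₀).1.trans (hx _ hb₀).1)
      (fun u hu v hv ↦ by rw [Finset.mem_singleton.1 hv]; exact (hx _ (hD hu)).1)
      (by simp; omega) (by
        intro i j hij hadj u hu v hv
        have h1 := hcut i j hij hadj
        by_cases hj : (j : ℕ) + 1 = h
        · have h2 := h1.2 hj
          have h3 : ¬ (i : ℕ) < #C := by omega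
          have h4 : (i : ℕ) < #C + #D := by omega
          have h5 : ¬ (j : ℕ) < #C := by omega
          have h6 : ¬ (j : ℕ) < #C + #D := by omega
          simp only [h3, h4, h5, h6, if_true, if_false, Finset.mem_singleton] at hu hv
          exact hv ▸ (hx u (hD hu)).2
        · have h2 := h1.1 hj
          have h3 : (i : ℕ) < #C := by omega
          have h5 : ¬ (j : ℕ) < #C := by omega
          have h6 : (j : ℕ) < #C + #D := by omega
          simp only [h3, h5, h6, if_true, if_false] at hu hv
          exact (hCD u hu v hv).2)
    rwa [Finset.union_comm, ← Finset.insert_eq] at this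
  · obtain ⟨C, hC, D, hD, cC, cD, hcard, hsub, hCD⟩ := sub (i := g) (j := r - 1) (by omega)
    refine ⟨C ∪ D, hsub, hcard, ?_⟩
    have := isCopySet_of_parts (H := H) (G := G) (D₁ := C) (D₂ := D) (D₃ := {x})
      (fun u hu v hv ↦ (hCD u hu v hv).1)
      (fun u hu v hv ↦ by
        rw [Finset.mem_singleton.1 hv]
        exact (hAB u (hC hu) b₀ hb₀).1.trans (hx a₀ ha₀ _ hb₀).1)
      (fun u hu v hv ↦ by rw [Finset.mem_singleton.1 hv]; exact (hx a₀ ha₀ _ (hD hu)).1)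
      (by simp; omega) (by
        intro i j hij hadj u hu v hv
        have h1 := hH.edge i j hij hadj
        have h2 : (i : ℕ) < #C := by omega
        have h3 : ¬ (j : ℕ) < #C := by omega
        simp only [h2, h3, if_true, if_false] at hu hv
        split_ifs at hv
        · exact (hCD u hu v hv).2
        · exact Finset.mem_singleton.1 hv ▸ (hx u (hC hu) b₀ hb₀).2)
    rwa [Finset.union_comm, ← Finset.insert_eq] at this
  · obtain ⟨C, hC, D, hD, cC, cD, hcard, hsub, hCD⟩ := sub (i := g) (j := r - 1) (by omega)
    refine ⟨C ∪ D, hsub, hcard, ?_⟩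
    have := isCopySet_of_parts (H := H) (G := G) (D₁ := C) (D₂ := {x}) (D₃ := D)
      (fun u hu v hv ↦ by rw [Finset.mem_singleton.1 hv]; exact (hx u (hC hu) b₀ hb₀).1)
      (fun u hu v hv ↦ (hCD u hu v hv).1)
      (fun u hu v hv ↦ by rw [Finset.mem_singleton.1 hu]; exact (hx a₀ ha₀ v (hD hv)).2)
      (by simp; omega) (by
        intro i j hij hadj u hu v hv
        have h1 := hH.edge i j hij hadj
        have h2 : (i : ℕ) < #C := by omega
        have h3 : ¬ (j : ℕ) < #C := by omega
        have h4 : ¬ (j : ℕ) < #C + 1 := by omega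
        simp only [Finset.card_singleton, h2, h3, h4, if_true, if_false] at hu hv
        exact (hCD u hu v hv).2)
    have e : insert x (C ∪ D) = C ∪ {x} ∪ D := by
      rw [Finset.insert_eq, Finset.union_comm C {x}, Finset.union_assoc]
    rwa [e]
  · obtain ⟨C, hC, D, hD, cC, cD, hcard, hsub, hCD⟩ := sub (i := r - 1) (j := g) (by omega)
    exact ⟨C ∪ D, hsub, hcard, hCD.isCopySet_insert hH h₀ (fun a ha ↦ hx a (hC ha))
      (fun b hb ↦ (hx a₀ ha₀).trans (hAB a₀ ha₀ b (hD hb)).1) (by omega) cD⟩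

lemma hasPerfectTilingOn_biUnion {ι : Type*} [DecidableEq ι] {S : ι → Finset (Fin n)}
    (I : Finset ι) : (I : Set ι).PairwiseDisjoint S → (∀ γ ∈ I, HasPerfectTilingOn H G (S γ)) →
      HasPerfectTilingOn H G (I.biUnion S) := by
  induction I using Finset.induction_on with
  | empty => exact fun _ _ ↦ .empty
  | insert γ I hγ ih =>
    intro hd hS
    rw [Finset.biUnion_insert]
    refine (hS γ (by simp)).union (ih (hd.subset (by simp)) fun γ' h' ↦ hS γ' (by simp [h'])) ?_
    rw [Finset.disjoint_biUnion_right]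
    exact fun γ' h' ↦ hd (by simp) (by simp [h']) (fun e ↦ hγ (e ▸ h'))

/-- If each gadget `S γ` can absorb any vertex that is good for it, together with `h - 1` vertices
of `Y`, then the gadgets can absorb all of `X ∪ Y`. -/
lemma hasPerfectTilingOn_of_absorb {ι : Type*} [DecidableEq ι] {S : ι → Finset (Fin n)}
    {good : Fin n → ι → Prop} [∀ x, DecidablePred (good x)] (hh : 0 < h) (k : ℕ) :
    ∀ (I : Finset ι) (X Y : Finset (Fin n)), #X + #Y = k → (I : Set ι).PairwiseDisjoint S →
      (∀ γ ∈ I, HasPerfectTilingOn H G (S γ)) →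
      (∀ γ ∈ I, ∀ x ∉ S γ, good x γ → ∀ Z ⊆ Y, #Z + 1 = h → x ∉ Z →
        HasPerfectTilingOn H G (S γ ∪ insert x Z)) →
      Disjoint X Y → (∀ γ ∈ I, Disjoint (X ∪ Y) (S γ)) →
      (∀ x ∈ X, #X ≤ #{γ ∈ I | good x γ}) → (∀ y ∈ Y, ∀ γ ∈ I, good y γ) →
      (h - 1) * #X ≤ #Y → h ∣ #X + #Y → #X + #Y ≤ #I →
      HasPerfectTilingOn H G (X ∪ Y ∪ I.biUnion S) := by
  induction k using Nat.strong_induction_on with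
  | _ k ih =>
  intro I X Y hk hd hS habs hXY hXYS hgX hgY hYX hdvd hI
  by_cases hzero : #X + #Y = 0
  · have hX : X = ∅ := Finset.card_eq_zero.1 (by omega)
    have hY : Y = ∅ := Finset.card_eq_zero.1 (by omega)
    rw [hX, hY, Finset.empty_union, Finset.empty_union]
    exact hasPerfectTilingOn_biUnion I hd hS
  obtain ⟨x, hx, Z, hZ, cZ, hxZ, γ, hγ, hgood, hX', hY'⟩ : ∃ x ∈ X ∪ Y, ∃ Z ⊆ Y, #Z + 1 = h ∧
      x ∉ Z ∧ ∃ γ ∈ I, good x γ ∧ (#(X.erase x) + 1 ≤ #X ∨ #(X.erase x) = 0) ∧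
        (h - 1) * #(X.erase x) ≤ #(Y \ insert x Z) := by
    rcases X.eq_empty_or_nonempty with rfl | ⟨x, hx⟩
    · have hY : h ≤ #Y := Nat.le_of_dvd (by rw [Finset.card_empty] at hzero; omega)
        (by simpa using hdvd)
      obtain ⟨y, hy⟩ : Y.Nonempty := Finset.card_pos.1 (by omega)
      obtain ⟨γ, hγ⟩ : I.Nonempty := Finset.card_pos.1 (by omega)
      obtain ⟨Z, hZ, cZ⟩ := Finset.exists_subset_card_eq (s := Y.erase y) (n := h - 1) (by
        rw [Finset.card_erase_of_mem hy]; omega)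
      exact ⟨y, by simp [hy], Z, hZ.trans (Finset.erase_subset ..), by omega,
        fun h ↦ by simpa using hZ h, γ, hγ, hgY y hy γ hγ, by simp, by simp⟩
    · have hX : 0 < #X := Finset.card_pos.2 ⟨x, hx⟩
      have hle : h - 1 ≤ #Y := (Nat.le_mul_of_pos_right _ hX).trans hYX
      obtain ⟨Z, hZ, cZ⟩ := Finset.exists_subset_card_eq hle
      obtain ⟨γ, hγ⟩ : {γ ∈ I | good x γ}.Nonempty :=
        Finset.card_pos.1 (hX.trans_le (hgX x hx))
      rw [Finset.mem_filter] at hγ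
      have hxY := Finset.disjoint_left.1 hXY hx
      have cX := Finset.card_erase_add_one hx
      refine ⟨x, by simp [hx], Z, hZ, by omega, fun h ↦ hxY (hZ h), γ, hγ.1, hγ.2,
        .inl cX.le, ?_⟩
      rw [Finset.sdiff_insert_of_notMem hxY, Finset.card_sdiff_of_subset hZ, cZ]
      rw [← cX, Nat.mul_succ] at hYX
      omega
  have hxS : x ∉ S γ := fun h ↦ Finset.disjoint_left.1 (hXYS γ hγ) hx h
  have h1 := habs γ hγ x hxS hgood Z hZ cZ hxZ
  have hsplit : X ∪ Y = insert x Z ∪ (X.erase x ∪ Y \ insert x Z) := by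
    ext v
    have := @hZ v
    simp only [Finset.mem_union, Finset.mem_insert, Finset.mem_erase, Finset.mem_sdiff] at hx ⊢
    by_cases hv : v = x
    · subst hv; tauto
    · tauto
  have hdis : Disjoint (insert x Z) (X.erase x ∪ Y \ insert x Z) := by
    have hXYv := Finset.disjoint_left.1 hXY
    refine Finset.disjoint_left.2 fun v hv hv' ↦ ?_
    have := @hZ v
    have := @hXYv v
    simp only [Finset.mem_union, Finset.mem_insert, Finset.mem_erase, Finset.mem_sdiff] at hv hv'
    tauto
  have hXY' : Disjoint (X.erase x) (Y \ insert x Z) :=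
    hXY.mono (Finset.erase_subset ..) Finset.sdiff_subset
  have hcard : #X + #Y = h + (#(X.erase x) + #(Y \ insert x Z)) := by
    rw [← Finset.card_union_of_disjoint hXY', ← Finset.card_union_of_disjoint hXY, hsplit,
      Finset.card_union_of_disjoint hdis, Finset.card_insert_of_notMem hxZ, cZ]
  have hdisS : Disjoint (X ∪ Y) (I.biUnion S) := (Finset.disjoint_biUnion_right ..).2 hXYS
  have hsub : X.erase x ∪ Y \ insert x Z ⊆ X ∪ Y := by rw [hsplit]; exact Finset.subset_union_right
  have h2 := ih (#(X.erase x) + #(Y \ insert x Z)) (by omega) (I.erase γ) (X.erase x)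
    (Y \ insert x Z) rfl (hd.subset (by simp)) (fun γ' h' ↦ hS γ' (Finset.mem_of_mem_erase h'))
    (fun γ' h' w hw hg Z' hZ' ↦ habs γ' (Finset.mem_of_mem_erase h') w hw hg Z'
      (hZ'.trans Finset.sdiff_subset)) hXY'
    (fun γ' h' ↦ (hXYS γ' (Finset.mem_of_mem_erase h')).mono_left hsub)
    (fun w hw ↦ by
      have := hgX w (Finset.mem_of_mem_erase hw)
      have h3 : #(X.erase x) ≠ 0 := Finset.card_ne_zero_of_mem hw
      have h4 := Finset.pred_card_le_card_erase (s := {γ' ∈ I | good w γ'}) (a := γ)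
      rw [← Finset.filter_erase] at h4
      omega)
    (fun y hy γ' h' ↦ hgY y (Finset.mem_sdiff.1 hy).1 γ' (Finset.mem_of_mem_erase h'))
    hY' ((Nat.dvd_add_right dvd_rfl).1 (hcard ▸ hdvd)) (by
      rw [Finset.card_erase_of_mem hγ]; omega)
  have hdisγ : Disjoint (S γ) ((I.erase γ).biUnion S) := by
    rw [Finset.disjoint_biUnion_right]
    exact fun γ' h' ↦ hd hγ (Finset.mem_of_mem_erase h') (Finset.ne_of_mem_erase h').symm
  have e : X ∪ Y ∪ I.biUnion S =
      (S γ ∪ insert x Z) ∪ (X.erase x ∪ Y \ insert x Z ∪ (I.erase γ).biUnion S) := by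
    conv_lhs => rw [← Finset.insert_erase hγ, Finset.biUnion_insert, hsplit]
    rw [Finset.union_union_union_comm, Finset.union_comm (insert x Z)]
  rw [e]
  refine h1.union h2 ?_
  refine Finset.disjoint_union_left.2 ⟨Finset.disjoint_union_right.2
    ⟨((hXYS γ hγ).mono_left hsub).symm, hdisγ⟩, Finset.disjoint_union_right.2
    ⟨hdis, hdisS.mono ?_ ?_⟩⟩
  · rw [hsplit]; exact Finset.subset_union_left
  · exact Finset.biUnion_subset_biUnion_of_subset_left _ (Finset.erase_subset ..)

end Absorb

section Counting

open Classical in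
lemma card_forall_rel_ge {X Y : Type*} [Fintype X] [Fintype Y] (P : X → Y → Prop) (m : ℕ)
    {δ : ℝ} (hδ : 0 ≤ δ)
    (hP : δ * Fintype.card X * Fintype.card Y ≤ #{p : X × Y | P p.1 p.2}) :
    δ ^ m * (Fintype.card X : ℝ) ^ m * Fintype.card Y ≤
      #{p : (Fin m → X) × Y | ∀ i, P (p.1 i) p.2} := by
  rcases isEmpty_or_nonempty Y with hY | hY
  · simp
  have hY0 : (0 : ℝ) < Fintype.card Y := by exact_mod_cast Fintype.card_pos
  set N : Y → ℝ := fun y ↦ #{x : X | P x y} with hN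
  have e₁ : (#{p : X × Y | P p.1 p.2} : ℝ) = ∑ y, N y := by
    have := Finset.card_eq_sum_card_fiberwise (s := {p : X × Y | P p.1 p.2}) (t := Finset.univ)
      (f := Prod.snd) (by simp)
    rw [this]
    push_cast
    refine Finset.sum_congr rfl fun y _ ↦ ?_
    simp only [hN, Nat.cast_inj]
    refine Finset.card_bij' (fun p _ ↦ p.1) (fun x _ ↦ (x, y)) ?_ ?_ ?_ ?_ <;> aesop
  have e₂ : (#{p : (Fin m → X) × Y | ∀ i, P (p.1 i) p.2} : ℝ) = ∑ y, N y ^ m := by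
    have := Finset.card_eq_sum_card_fiberwise (s := {p : (Fin m → X) × Y | ∀ i, P (p.1 i) p.2})
      (t := Finset.univ) (f := Prod.snd) (by simp)
    rw [this]
    push_cast
    refine Finset.sum_congr rfl fun y _ ↦ ?_
    have : #(Fintype.piFinset fun _ : Fin m ↦ ({x : X | P x y} : Finset X)) =
        #{x : X | P x y} ^ m := by simp
    rw [hN]
    simp only
    rw [← Nat.cast_pow, ← this]
    norm_cast
    refine Finset.card_bij' (fun p _ ↦ p.1) (fun x _ ↦ (x, y)) ?_ ?_ ?_ ?_ <;> aesop
  rw [e₁] at hP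
  rw [e₂]
  have key := Real.pow_arith_mean_le_arith_mean_pow Finset.univ
    (fun _ : Y ↦ (Fintype.card Y : ℝ)⁻¹) N (fun _ _ ↦ by positivity)
    (by rw [Finset.sum_const, Finset.card_univ, nsmul_eq_mul, mul_inv_cancel₀ hY0.ne'])
    (fun _ _ ↦ by positivity) m
  rw [← Finset.mul_sum, ← Finset.mul_sum] at key
  have h1 : (δ * Fintype.card X) ^ m ≤ ((Fintype.card Y : ℝ)⁻¹ * ∑ y, N y) ^ m := by
    refine pow_le_pow_left₀ (by positivity) ?_ m
    rw [inv_mul_eq_div, le_div_iff₀ hY0]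
    exact hP
  have h2 := h1.trans key
  rw [inv_mul_eq_div, le_div_iff₀ hY0] at h2
  rwa [← mul_pow]

open Classical in
lemma card_forall_forall_rel_ge {X Y : Type*} [Fintype X] [Fintype Y] (P : X → Y → Prop) (m : ℕ)
    {δ : ℝ} (hδ : 0 ≤ δ)
    (hP : δ * Fintype.card X * Fintype.card Y ≤ #{p : X × Y | P p.1 p.2}) :
    δ ^ (m * m) * (Fintype.card X : ℝ) ^ m * (Fintype.card Y : ℝ) ^ m ≤
      #{q : (Fin m → X) × (Fin m → Y) | ∀ i j, P (q.1 i) (q.2 j)} := by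
  have h1 := card_forall_rel_ge P m hδ hP
  have h2 := card_forall_rel_ge (X := Y) (Y := Fin m → X) (fun y f ↦ ∀ i, P (f i) y) m
    (δ := δ ^ m) (by positivity) (by
      rw [← Finset.card_map (Equiv.prodComm _ _).toEmbedding] at h1
      convert h1 using 1
      · simp; ring
      · congr 2; ext; simp)
  rw [← Finset.card_map (Equiv.prodComm _ _).toEmbedding] at h2
  convert h2 using 1
  · simp [pow_mul]; ring
  · congr 2; ext q; simp only [Finset.mem_filter, Finset.mem_univ, true_and,
      Finset.mem_map_equiv]; exact forall_comm

open Classical in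
lemma card_apply_mem_mul_le {V : Type*} [Fintype V] {m : ℕ} (U : Finset V) (i : Fin m) :
    #{f : Fin m → V | f i ∈ U} * Fintype.card V ≤ #U * Fintype.card V ^ m := by
  have : #(({f : Fin m → V | f i ∈ U} : Finset _) ×ˢ (Finset.univ : Finset V)) ≤
      #(U ×ˢ (Finset.univ : Finset (Fin m → V))) := by
    refine Finset.card_le_card_of_injOn (fun p ↦ (p.1 i, Function.update p.1 i p.2)) ?_ ?_
    · rintro ⟨f, v⟩ hp
      simpa using hp
    · rintro ⟨f, v⟩ _ ⟨f', v'⟩ _ hp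
      simp only [Prod.mk.injEq] at hp ⊢
      refine ⟨?_, by simpa using congrFun hp.2 i⟩
      funext j
      rcases eq_or_ne j i with rfl | hj
      · exact hp.1
      · simpa [hj] using congrFun hp.2 j
  simpa [Finset.card_product] using this

open Classical in
lemma card_apply_eq_apply_mul_le {V : Type*} [Fintype V] {m : ℕ} {i j : Fin m} (hij : i ≠ j) :
    #{f : Fin m → V | f i = f j} * Fintype.card V ≤ Fintype.card V ^ m := by
  have : #(({f : Fin m → V | f i = f j} : Finset _) ×ˢ (Finset.univ : Finset V)) ≤
      #(Finset.univ : Finset (Fin m → V)) := by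
    refine Finset.card_le_card_of_injOn (fun p ↦ Function.update p.1 i p.2) (by simp) ?_
    rintro ⟨f, v⟩ hf ⟨f', v'⟩ hf' hp
    simp only [Finset.coe_product, Finset.coe_filter, Finset.mem_univ, true_and,
      Finset.coe_univ, Set.mem_prod, Set.mem_ofPred_eq, Set.mem_univ, and_true,
      Prod.mk.injEq] at hf hf' hp ⊢
    refine ⟨?_, by simpa using congrFun hp i⟩
    have hj : f j = f' j := by simpa [hij.symm] using congrFun hp j
    funext k
    rcases eq_or_ne k i with rfl | hk
    · rw [hf, hf', hj]
    · simpa [hk] using congrFun hp k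
  simpa [Finset.card_product] using this

open Classical in
lemma card_not_injective_or_meets_mul_le {V : Type*} [Fintype V] (m : ℕ) (U : Finset V) :
    #{f : Fin m → V | ¬ (f.Injective ∧ ∀ i, f i ∉ U)} * Fintype.card V ≤
      (m * m + m * #U) * Fintype.card V ^ m := by
  have hsub : ({f : Fin m → V | ¬ (f.Injective ∧ ∀ i, f i ∉ U)} : Finset _) ⊆
      ((Finset.univ : Finset (Fin m × Fin m)).filter fun p ↦ p.1 ≠ p.2).biUnion
          (fun p ↦ {f : Fin m → V | f p.1 = f p.2}) ∪
        (Finset.univ : Finset (Fin m)).biUnion (fun i ↦ {f : Fin m → V | f i ∈ U}) := by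
    intro f hf
    simp only [Finset.mem_filter, Finset.mem_univ, true_and, not_and_or, Function.Injective,
      not_forall, not_not] at hf
    simp only [Finset.mem_union, Finset.mem_biUnion, Finset.mem_filter, Finset.mem_univ, true_and,
      Prod.exists]
    rcases hf with ⟨a, b, hab, hne⟩ | ⟨i, hi⟩
    · exact .inl ⟨a, b, hne, hab⟩
    · exact .inr ⟨i, hi⟩
  refine (Nat.mul_le_mul_right _ ((Finset.card_le_card hsub).trans
    (Finset.card_union_le ..))).trans ?_
  rw [add_mul, add_mul]
  refine add_le_add ?_ ?_
  · refine (Nat.mul_le_mul_right _ Finset.card_biUnion_le).trans ?_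
    rw [Finset.sum_mul]
    refine (Finset.sum_le_card_nsmul _ _ _ fun p hp ↦
      card_apply_eq_apply_mul_le (Finset.mem_filter.1 hp).2).trans ?_
    rw [smul_eq_mul]
    refine Nat.mul_le_mul_right _ ((Finset.card_filter_le ..).trans ?_)
    simp
  · refine (Nat.mul_le_mul_right _ Finset.card_biUnion_le).trans ?_
    rw [Finset.sum_mul]
    refine (Finset.sum_le_card_nsmul _ _ _ fun i _ ↦ card_apply_mem_mul_le U i).trans ?_
    simp [mul_assoc]

open Classical in
/-- A relation on `Fin n` of positive density has a positive density of complete `m × m` blow-ups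
with distinct vertices, even when a small set of vertices is forbidden. -/
lemma exists_card_blowup_ge (m : ℕ) {δ : ℝ} (hδ : 0 < δ) :
    ∃ ρ : ℝ, 0 < ρ ∧ ∃ n₀ : ℕ, ∀ n ≥ n₀, ∀ (P : Fin n → Fin n → Prop) (U : Finset (Fin n)),
      δ * n ^ 2 ≤ #{p : Fin n × Fin n | P p.1 p.2} → #U ≤ ρ * n →
      δ ^ (m * m) / 2 * ((n : ℝ) ^ m * n ^ m) ≤
        #{q : (Fin m → Fin n) × (Fin m → Fin n) | (q.1.Injective ∧ ∀ i, q.1 i ∉ U) ∧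
          (q.2.Injective ∧ ∀ i, q.2 i ∉ U) ∧ ∀ i j, P (q.1 i) (q.2 j)} := by
  set κ : ℝ := δ ^ (m * m) / 2 with hκ
  have hκ0 : 0 < κ := by positivity
  refine ⟨κ / (4 * (m + 1)), by positivity, ⌈4 * (m * m) / κ⌉₊ + 1, fun n hn P U hP hU ↦ ?_⟩
  have hn0 : (0 : ℝ) < n := by exact_mod_cast (by omega : 0 < n)
  have h1 := card_forall_forall_rel_ge P m hδ.le (by simpa [pow_two, mul_assoc] using hP)
  simp only [Fintype.card_fin] at h1
  set Q : Finset ((Fin m → Fin n) × (Fin m → Fin n)) := {q | ∀ i j, P (q.1 i) (q.2 j)} with hQ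
  set bad : Finset (Fin m → Fin n) := {f | ¬ (f.Injective ∧ ∀ i, f i ∉ U)} with hbad
  have hb : #bad * n ≤ (m * m + m * #U) * n ^ m := by
    have := card_not_injective_or_meets_mul_le m U
    rw [Fintype.card_fin] at this
    convert this
  have hb' : (#bad : ℝ) * n ≤ (m * m + m * #U) * n ^ m := by exact_mod_cast hb
  have hbm : (#bad : ℝ) ≤ κ / 2 * n ^ m := by
    have h2 : (m * m : ℝ) ≤ κ / 4 * n := by
      have : 4 * (m * m) / κ ≤ n := (Nat.le_ceil _).trans (Nat.cast_le.2 (by omega))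
      rw [div_le_iff₀ hκ0] at this
      linarith
    have h3 : (m * #U : ℝ) ≤ κ / 4 * n := by
      have : (m * #U : ℝ) ≤ (m + 1) * (κ / (4 * (m + 1)) * n) :=
        mul_le_mul (by linarith) hU (by positivity) (by positivity)
      refine this.trans_eq ?_
      field_simp
    have h4 : (m * m + m * #U : ℝ) * n ^ m ≤ (κ / 2 * n) * n ^ m :=
      mul_le_mul_of_nonneg_right (by linarith) (by positivity)
    have h5 : (#bad : ℝ) * n ≤ (κ / 2 * n ^ m) * n := hb'.trans (h4.trans_eq (by ring))
    exact le_of_mul_le_mul_right h5 hn0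
  set T := ({q : (Fin m → Fin n) × (Fin m → Fin n) | (q.1.Injective ∧ ∀ i, q.1 i ∉ U) ∧
          (q.2.Injective ∧ ∀ i, q.2 i ∉ U) ∧ ∀ i j, P (q.1 i) (q.2 j)} : Finset _) with hT
  have hsub : Q ⊆ T ∪ (bad ×ˢ Finset.univ ∪ Finset.univ ×ˢ bad) := by
    intro q hq
    simp only [hQ, hT, hbad, Finset.mem_filter, Finset.mem_univ, true_and, Finset.mem_union,
      Finset.mem_product, and_true] at hq ⊢
    tauto
  have hle : #Q ≤ #T + (#bad * n ^ m + n ^ m * #bad) := by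
    refine (Finset.card_le_card hsub).trans ((Finset.card_union_le ..).trans ?_)
    refine Nat.add_le_add_left ((Finset.card_union_le ..).trans_eq ?_) _
    simp [Finset.card_product]
  have hle' : (#Q : ℝ) ≤ #T + (#bad * n ^ m + n ^ m * #bad) := by exact_mod_cast hle
  have h6 : (#bad : ℝ) * n ^ m ≤ κ / 2 * n ^ m * n ^ m :=
    mul_le_mul_of_nonneg_right hbm (by positivity)
  have h7 : δ ^ (m * m) = 2 * κ := by rw [hκ]; ring
  rw [h7] at h1
  nlinarith

end Counting

section Gadgets

variable {n : ℕ} {G : SimpleGraph (Fin n)}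

/-- The four ways in which a vertex `x` may fit an edge `ab` with `a < b`. -/
def FitsEdge (G : SimpleGraph (Fin n)) (x : Fin n) (τ : Fin 4) (a b : Fin n) : Prop :=
  (a < b ∧ G.Adj a b) ∧ match τ with
    | 0 => b < x ∧ G.Adj b x
    | 1 => b < x ∧ G.Adj a x
    | 2 => a < x ∧ x < b
    | 3 => x < a

lemma fits_of_forall_fitsEdge {x : Fin n} {τ : Fin 4} {A B : Finset (Fin n)} (hA : A.Nonempty)
    (hB : B.Nonempty) (h : ∀ a ∈ A, ∀ b ∈ B, FitsEdge G x τ a b) : Fits G x A B := by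
  obtain ⟨a₀, ha₀⟩ := hA
  obtain ⟨b₀, hb₀⟩ := hB
  match τ with
  | 0 => exact .inl fun b hb ↦ (h a₀ ha₀ b hb).2
  | 1 => exact .inr (.inl fun a ha b hb ↦ (h a ha b hb).2)
  | 2 => exact .inr (.inr (.inl fun a ha b hb ↦ (h a ha b hb).2))
  | 3 => exact .inr (.inr (.inr fun a ha ↦ (h a ha b₀ hb₀).2))

open Classical in
lemma odeg_eq_card (v : Fin n) : odeg G v = #{w | G.Adj v w} := by
  rw [odeg, ← Set.ncard_coe_finset]
  congr 1
  ext w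
  simp

open Classical in
lemma exists_fitsEdge_card_ge {d : ℝ} (hd : 0 ≤ d) (hG : ∀ v, d ≤ odeg G v) (x : Fin n) :
    ∃ τ, (d ^ 2 - n) / 8 ≤ #{p : Fin n × Fin n | FitsEdge G x τ p.1 p.2} := by
  by_contra! hcon
  set W : Finset (Σ _ : Fin n, Fin n) :=
    ({u | G.Adj x u} : Finset (Fin n)).sigma fun u ↦ {w | G.Adj u w} with hW
  have h1 : d ^ 2 ≤ #W := by
    rw [hW, Finset.card_sigma]
    push_cast
    calc d ^ 2 ≤ #{u | G.Adj x u} * d := by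
          rw [pow_two]
          exact mul_le_mul_of_nonneg_right (odeg_eq_card (G := G) x ▸ hG x) hd
      _ = ∑ u with G.Adj x u, d := by rw [Finset.sum_const, nsmul_eq_mul]
      _ ≤ _ := Finset.sum_le_sum fun u _ ↦ odeg_eq_card (G := G) u ▸ hG u
  let R (τ : Fin 4) : Finset (Fin n × Fin n) := {p | FitsEdge G x τ p.1 p.2}
  have hsub : W ⊆ (Finset.univ : Finset (Fin n)).image (fun u ↦ ⟨u, x⟩) ∪
      Finset.univ.biUnion fun τ ↦ (R τ).image (fun p ↦ ⟨p.1, p.2⟩) ∪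
        (R τ).image (fun p ↦ ⟨p.2, p.1⟩) := by
    rintro ⟨u, v⟩ huv
    simp only [hW, Finset.mem_sigma, Finset.mem_filter, Finset.mem_univ, true_and] at huv
    obtain ⟨hxu, huv⟩ := huv
    simp only [Finset.mem_union, Finset.mem_image, Finset.mem_univ, true_and, Finset.mem_biUnion,
      Sigma.mk.injEq, heq_eq_eq, Prod.exists, R, Finset.mem_filter]
    by_cases hvx : v = x
    · exact .inl ⟨u, rfl, hvx.symm⟩
    refine .inr ?_
    have hne := hxu.ne
    rcases lt_or_gt_of_ne huv.ne with h | h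
    · suffices ∃ τ, FitsEdge G x τ u v from
        this.imp fun τ hτ ↦ .inl ⟨u, v, hτ, rfl, rfl⟩
      rcases lt_or_gt_of_ne hne with h' | h'
      · exact ⟨3, ⟨h, huv⟩, h'⟩
      · rcases lt_or_gt_of_ne hvx with h'' | h''
        · exact ⟨1, ⟨h, huv⟩, h'', hxu.symm⟩
        · exact ⟨2, ⟨h, huv⟩, h', h''⟩
    · suffices ∃ τ, FitsEdge G x τ v u from
        this.imp fun τ hτ ↦ .inr ⟨v, u, hτ, rfl, rfl⟩
      rcases lt_or_gt_of_ne hvx with h' | h'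
      · rcases lt_or_gt_of_ne hne with h'' | h''
        · exact ⟨2, ⟨h, huv.symm⟩, h', h''⟩
        · exact ⟨0, ⟨h, huv.symm⟩, h'', hxu.symm⟩
      · exact ⟨3, ⟨h, huv.symm⟩, h'⟩
  have h2 : #W ≤ n + ∑ τ, (#(R τ) + #(R τ)) := by
    refine (Finset.card_le_card hsub).trans ((Finset.card_union_le ..).trans ?_)
    refine add_le_add (Finset.card_image_le.trans (by simp)) ?_
    refine Finset.card_biUnion_le.trans (Finset.sum_le_sum fun τ _ ↦ ?_)
    exact (Finset.card_union_le ..).trans (add_le_add Finset.card_image_le Finset.card_image_le)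
  have h3 : (#W : ℝ) ≤ n + ∑ τ, ((#(R τ) : ℝ) + #(R τ)) := by exact_mod_cast h2
  have h4 : ∑ τ, ((#(R τ) : ℝ) + #(R τ)) < ∑ _τ : Fin 4, ((d ^ 2 - n) / 8 + (d ^ 2 - n) / 8) :=
    Finset.sum_lt_sum_of_nonempty Finset.univ_nonempty fun τ _ ↦ add_lt_add (hcon τ) (hcon τ)
  simp only [Finset.sum_const, Finset.card_univ, Fintype.card_fin, nsmul_eq_mul] at h4
  push_cast at h4
  linarith

open Classical in
/-- In a graph of linear minimum degree, every vertex `x` fits a positive proportion of the pairs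
of `m`-tuples, even when a small set of vertices is forbidden. -/
lemma exists_card_fits_ge (m : ℕ) (hm : 0 < m) {η : ℝ} (hη : 0 < η) :
    ∃ β : ℝ, 0 < β ∧ ∃ ρ : ℝ, 0 < ρ ∧ ∃ n₀ : ℕ, ∀ n ≥ n₀, ∀ G : SimpleGraph (Fin n),
      (∀ v, η * n ≤ odeg G v) → ∀ (x : Fin n) (U : Finset (Fin n)), #U ≤ ρ * n →
      β * ((n : ℝ) ^ m * n ^ m) ≤
        #{q : (Fin m → Fin n) × (Fin m → Fin n) | (q.1.Injective ∧ q.2.Injective ∧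
          CompletePair G (univ.image q.1) (univ.image q.2) ∧
          Fits G x (univ.image q.1) (univ.image q.2)) ∧
          Disjoint (univ.image q.1 ∪ univ.image q.2) U} := by
  obtain ⟨ρ, hρ, n₀, hn₀⟩ := exists_card_blowup_ge m (δ := η ^ 2 / 16) (by positivity)
  refine ⟨(η ^ 2 / 16) ^ (m * m) / 2, by positivity, ρ, hρ, max n₀ (⌈2 / η ^ 2⌉₊),
    fun n hn G hG x U hU ↦ ?_⟩
  obtain ⟨τ, hτ⟩ := exists_fitsEdge_card_ge (by positivity) hG x
  have h1 : (2 / η ^ 2 : ℝ) ≤ n :=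
    (Nat.le_ceil _).trans (Nat.cast_le.2 ((le_max_right _ _).trans hn))
  rw [div_le_iff₀ (by positivity)] at h1
  have h2 := hn₀ n ((le_max_left _ _).trans hn) (FitsEdge G x τ) U (by
    refine le_trans ?_ hτ
    have : (2 * n : ℝ) ≤ n * η ^ 2 * n := mul_le_mul_of_nonneg_right h1 (by positivity)
    nlinarith) hU
  refine h2.trans (Nat.cast_le.2 (Finset.card_le_card fun q hq ↦ ?_))
  simp only [Finset.mem_filter, Finset.mem_univ, true_and] at hq ⊢
  obtain ⟨⟨hi₁, hu₁⟩, ⟨hi₂, hu₂⟩, hfit⟩ := hq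
  have hne : (Finset.univ : Finset (Fin m)).Nonempty := ⟨⟨0, hm⟩, by simp⟩
  have hfit' : ∀ a ∈ univ.image q.1, ∀ b ∈ univ.image q.2, FitsEdge G x τ a b := by
    simpa using hfit
  refine ⟨⟨hi₁, hi₂, fun a ha b hb ↦ (hfit' a ha b hb).1,
    fits_of_forall_fitsEdge (hne.image _) (hne.image _) hfit'⟩, ?_⟩
  rw [Finset.disjoint_left]
  intro v hv
  simp only [Finset.mem_union, Finset.mem_image, Finset.mem_univ, true_and] at hv
  rcases hv with ⟨i, rfl⟩ | ⟨i, rfl⟩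
  exacts [hu₁ i, hu₂ i]

open Classical in
/-- Greedy selection of disjoint gadgets by the method of conditional expectations. -/
lemma exists_selection {V Γ : Type*} [Fintype V] [Nonempty V] [Fintype Γ]
    [Nonempty Γ] (supp : Γ → Finset V)
    (good : V → Γ → Prop) {s u : ℕ} {β : ℝ} (hβ : 0 < β) (hsupp : ∀ γ, (supp γ).Nonempty)
    (hs : ∀ γ, #(supp γ) ≤ s)
    (hgood : ∀ x, ∀ U : Finset V, #U ≤ u →
      β * Fintype.card Γ ≤ #{γ | good x γ ∧ Disjoint (supp γ) U}) (U₀ : Finset V) (N : ℕ) :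
    #U₀ + s * N ≤ u → ∃ F : Finset Γ, #F = N ∧ (F : Set Γ).PairwiseDisjoint supp ∧
      (∀ γ ∈ F, Disjoint (supp γ) U₀ ∧ ∃ x, good x γ) ∧
      ∑ x, (1 / 2 : ℝ) ^ #{γ ∈ F | good x γ} ≤ Fintype.card V * (1 - β / 2) ^ N := by
  induction N with
  | zero => exact fun _ ↦ ⟨∅, by simp⟩
  | succ N ih =>
    intro hu
    obtain ⟨F, cF, hF, hF', hsum⟩ := ih (by rw [Nat.mul_succ] at hu; omega)
    set U := U₀ ∪ F.biUnion supp with hU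
    have cU : #U ≤ u := by
      refine (Finset.card_union_le ..).trans (le_trans ?_ hu)
      refine Nat.add_le_add_left (Finset.card_biUnion_le.trans ?_) _
      refine (Finset.sum_le_card_nsmul _ _ _ fun γ _ ↦ hs γ).trans ?_
      rw [cF, smul_eq_mul, Nat.mul_succ, mul_comm]
      omega
    set w : V → ℝ := fun x ↦ (1 / 2 : ℝ) ^ #{γ ∈ F | good x γ} with hw
    have hw0 : ∀ x, 0 < w x := fun x ↦ by positivity
    have hW0 : 0 < ∑ x, w x := Finset.sum_pos (fun x _ ↦ hw0 x) Finset.univ_nonempty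
    obtain ⟨x₀⟩ := ‹Nonempty V›
    have hΓ0 : (0 : ℝ) < Fintype.card Γ := Nat.cast_pos.2 Fintype.card_pos
    obtain ⟨γ, hγU, hγ⟩ : ∃ γ, Disjoint (supp γ) U ∧
        β * ∑ x, w x ≤ ∑ x, if good x γ then w x else 0 := by
      by_contra! hcon
      have h1 : ∑ γ with Disjoint (supp γ) U, ∑ x, (if good x γ then w x else 0) =
          ∑ x, w x * #{γ | good x γ ∧ Disjoint (supp γ) U} := by
        rw [Finset.sum_comm]
        refine Finset.sum_congr rfl fun x _ ↦ ?_
        rw [← Finset.sum_filter, Finset.sum_const, nsmul_eq_mul, mul_comm, Finset.filter_filter]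
        simp only [and_comm]
      have h2 : β * Fintype.card Γ * ∑ x, w x ≤
          ∑ x, w x * #{γ | good x γ ∧ Disjoint (supp γ) U} := by
        rw [Finset.mul_sum]
        refine Finset.sum_le_sum fun x _ ↦ ?_
        rw [mul_comm]
        exact mul_le_mul_of_nonneg_left (hgood x U cU) (hw0 x).le
      have hΓ : ({γ | Disjoint (supp γ) U} : Finset Γ).Nonempty := by
        have hpos : (0 : ℝ) < #{γ | good x₀ γ ∧ Disjoint (supp γ) U} :=
          (mul_pos hβ hΓ0).trans_le (hgood x₀ U cU)
        obtain ⟨γ, hγ⟩ := Finset.card_pos.1 (Nat.cast_pos.1 hpos)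
        exact ⟨γ, Finset.mem_filter.2 ⟨Finset.mem_univ _, (Finset.mem_filter.1 hγ).2.2⟩⟩
      have h3 : ∑ γ with Disjoint (supp γ) U, ∑ x, (if good x γ then w x else 0) <
          ∑ γ with Disjoint (supp γ) U, β * ∑ x, w x :=
        Finset.sum_lt_sum_of_nonempty hΓ fun γ hγ ↦ hcon γ (Finset.mem_filter.1 hγ).2
      rw [Finset.sum_const, nsmul_eq_mul] at h3
      have h4 : (#{γ | Disjoint (supp γ) U} : ℝ) ≤ Fintype.card Γ := by
        exact_mod_cast Finset.card_le_univ _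
      have h5 := mul_le_mul_of_nonneg_right h4 (mul_pos hβ hW0).le
      linarith
    have hγF : γ ∉ F := fun h ↦ by
      obtain ⟨v, hv⟩ := hsupp γ
      exact Finset.disjoint_left.1 hγU hv
        (Finset.mem_union_right _ (Finset.mem_biUnion.2 ⟨γ, h, hv⟩))
    refine ⟨insert γ F, by rw [Finset.card_insert_of_notMem hγF, cF], ?_, ?_, ?_⟩
    · rw [Finset.coe_insert]
      refine hF.insert fun γ' h' _ ↦ hγU.mono_right ?_
      exact (Finset.subset_biUnion_of_mem supp h').trans Finset.subset_union_right
    · intro γ' h'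
      rcases Finset.mem_insert.1 h' with rfl | h'
      · refine ⟨hγU.mono_right Finset.subset_union_left, ?_⟩
        by_contra! hcon
        simp only [hcon, if_false, Finset.sum_const_zero] at hγ
        exact absurd hγ (mul_pos hβ hW0).not_ge
      · exact hF' γ' h'
    · have h1 : ∀ x, (1 / 2 : ℝ) ^ #{γ' ∈ insert γ F | good x γ'} =
          w x - 1 / 2 * if good x γ then w x else 0 := by
        intro x
        rw [Finset.filter_insert]
        split_ifs with hx
        · rw [Finset.card_insert_of_notMem (by simp [hγF]), pow_succ]
          ring
        · simp [hw]
      simp only [h1]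
      rw [Finset.sum_sub_distrib, ← Finset.mul_sum]
      have h2 : β ≤ 1 := by
        refine le_of_mul_le_mul_right ((hgood x₀ U cU).trans ?_) hΓ0
        rw [one_mul]
        exact Nat.cast_le.2 (Finset.card_le_univ _)
      have h3 := mul_le_mul_of_nonneg_right hsum (show 0 ≤ 1 - β / 2 by linarith)
      rw [pow_succ, ← mul_assoc]
      linarith

end Gadgets

section LightCopy

lemma card_filter_product_eq_sum {V : Type*} (R : Finset V) (P : V → V → Prop)
    [∀ u, DecidablePred (P u)] [DecidablePred fun p : V × V ↦ P p.1 p.2] :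
    #{p ∈ R ×ˢ R | P p.1 p.2} = ∑ u ∈ R, #{v ∈ R | P u v} := by
  rw [← Finset.card_sigma]
  refine Finset.card_bij' (fun p _ ↦ ⟨p.1, p.2⟩) (fun p _ ↦ (p.1, p.2)) ?_ ?_ ?_ ?_ <;> aesop

open Classical in
/-- If all degrees within `R` exceed `(g / (g + r) + η) * #R`, then a positive proportion of pairs
of adjacent vertices has weighted average at most slightly above the average of `z` over `R`. -/
lemma card_light_pairs_ge {V : Type*} {R : Finset V} {adj : V → V → Prop} {z : V → ℝ}
    {g r η ε s : ℝ} (hg : 0 < g) (hr : 0 ≤ r) (hs : 0 < s) (hs₁ : s < 1) (hsη : 2 * s ≤ η)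
    (hsε : s * (g + r) < ε) (hR : R.Nonempty) (hz₀ : ∀ v, 0 ≤ z v) (hz₁ : ∀ v, z v ≤ 1)
    (hdeg : ∀ v ∈ R, (g / (g + r) + η) * #R ≤ #{w ∈ R | adj v w}) :
    s ^ 2 * #R ^ 2 ≤ #{p ∈ R ×ˢ R | adj p.1 p.2 ∧
      r * z p.1 + g * z p.2 ≤ (g + r) * ((∑ v ∈ R, z v) / #R) + ε} := by
  have hρ : (0 : ℝ) < #R := Nat.cast_pos.2 (Finset.card_pos.2 hR)
  obtain ⟨ρ, hρdef⟩ : ∃ ρ : ℝ, ρ = #R := ⟨_, rfl⟩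
  rw [← hρdef] at hρ hdeg ⊢
  obtain ⟨a, ha⟩ : ∃ a : ℝ, a = (∑ v ∈ R, z v) / ρ := ⟨_, rfl⟩
  rw [← ha]
  have haρ : ∑ v ∈ R, z v = a * ρ := by rw [ha, div_mul_cancel₀ _ hρ.ne']
  by_contra! hcon
  set light : V → V → Prop := fun u v ↦ adj u v ∧ r * z u + g * z v ≤ (g + r) * a + ε with hlight
  set bad : Finset V := {u ∈ R | s * ρ < #{v ∈ R | light u v}} with hbad
  have hbadR : bad ⊆ R := Finset.filter_subset ..
  have hcount : (#{p ∈ R ×ˢ R | light p.1 p.2} : ℝ) = ∑ u ∈ R, (#{v ∈ R | light u v} : ℝ) := by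
    exact_mod_cast card_filter_product_eq_sum R light
  have hbadcard : #bad < s * ρ := by
    have h1 : #bad * (s * ρ) ≤ ∑ u ∈ R, (#{v ∈ R | light u v} : ℝ) := by
      rw [← nsmul_eq_mul]
      refine (Finset.card_nsmul_le_sum _ _ _ fun u hu ↦ (Finset.mem_filter.1 hu).2.le).trans ?_
      exact Finset.sum_le_sum_of_subset_of_nonneg hbadR fun _ _ _ ↦ Nat.cast_nonneg _
    rw [← hcount] at h1
    have h2 : #bad * (s * ρ) < (s * ρ) * (s * ρ) := h1.trans_lt (hcon.trans_eq (by ring))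
    exact lt_of_mul_lt_mul_right h2 (mul_pos hs hρ).le
  have hne : (R \ bad).Nonempty := by
    rw [Finset.sdiff_nonempty]
    intro hsub
    have : ρ ≤ #bad := hρdef ▸ Nat.cast_le.2 (Finset.card_le_card hsub)
    nlinarith
  obtain ⟨u, hu, hmin⟩ := Finset.exists_min_image (R \ bad) z hne
  rw [Finset.mem_sdiff] at hu
  have hul : (#{v ∈ R | light u v} : ℝ) ≤ s * ρ := by
    by_contra! h
    exact hu.2 (Finset.mem_filter.2 ⟨hu.1, h⟩)
  set ζ := z u with hζ
  set Q : Finset V := {v ∈ R | adj u v} \ ({v ∈ R | light u v} ∪ bad) with hQ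
  have hQR : Q ⊆ R \ bad := fun v hv ↦ by
    simp only [hQ, Finset.mem_sdiff, Finset.mem_filter, Finset.mem_union, not_or] at hv ⊢
    exact ⟨hv.1.1, hv.2.2⟩
  have hQcard : g / (g + r) * ρ ≤ #Q := by
    have h1 : #{v ∈ R | adj u v} - #({v ∈ R | light u v} ∪ bad) ≤ #Q := Finset.le_card_sdiff ..
    have h2 := Finset.card_union_le {v ∈ R | light u v} bad
    have h3 : #{v ∈ R | adj u v} ≤ #Q + (#{v ∈ R | light u v} + #bad) := by omega
    have h4 : (#{v ∈ R | adj u v} : ℝ) ≤ #Q + (#{v ∈ R | light u v} + #bad) := by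
      exact_mod_cast h3
    have h5 := hdeg u hu.1
    nlinarith
  have hQz : ∀ v ∈ Q, (g + r) * a + ε - r * ζ ≤ g * z v := fun v hv ↦ by
    simp only [hQ, Finset.mem_sdiff, Finset.mem_filter, Finset.mem_union, not_or] at hv
    have : ¬ light u v := fun h ↦ hv.2.1 ⟨hv.1.1, h⟩
    simp only [hlight, not_and, not_le] at this
    linarith [this hv.1.2]
  have hsum₁ : ∑ v ∈ R \ bad, z v ≤ a * ρ := haρ ▸
    Finset.sum_le_sum_of_subset_of_nonneg Finset.sdiff_subset fun _ _ _ ↦ hz₀ _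
  have hcard : (#(R \ bad) : ℝ) = ρ - #bad := by
    rw [Finset.card_sdiff_of_subset hbadR, Nat.cast_sub (Finset.card_le_card hbadR), hρdef]
  have hζ₁ : ζ ≤ 1 := hz₁ u
  have hζ₀ : 0 ≤ ζ := hz₀ u
  have hbadζ : #bad * ζ ≤ s * ρ := by
    nlinarith [show (0 : ℝ) ≤ #bad from Nat.cast_nonneg _]
  have hh : 0 < g + r := by linarith
  rcases le_total ((g + r) * ζ) ((g + r) * a + ε) with hle | hle
  · have h1 : ∑ v ∈ R \ bad, g * z v = ∑ v ∈ (R \ bad) \ Q, g * z v + ∑ v ∈ Q, g * z v :=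
      (Finset.sum_sdiff hQR).symm
    have h2 : #Q * ((g + r) * a + ε - r * ζ) ≤ ∑ v ∈ Q, g * z v := by
      rw [← nsmul_eq_mul]
      exact Finset.card_nsmul_le_sum _ _ _ hQz
    have h3 : #((R \ bad) \ Q) * (g * ζ) ≤ ∑ v ∈ (R \ bad) \ Q, g * z v := by
      rw [← nsmul_eq_mul]
      exact Finset.card_nsmul_le_sum _ _ _ fun v hv ↦
        mul_le_mul_of_nonneg_left (hmin v (Finset.mem_sdiff.1 hv).1) hg.le
    rw [Finset.card_sdiff_of_subset hQR, Nat.cast_sub (Finset.card_le_card hQR), hcard] at h3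
    rw [← Finset.mul_sum] at h1
    have h4 : g / (g + r) * ρ * ((g + r) * a + ε - (g + r) * ζ) ≤
        #Q * ((g + r) * a + ε - (g + r) * ζ) :=
      mul_le_mul_of_nonneg_right hQcard (by linarith)
    have h5 : g / (g + r) * ρ * ((g + r) * a + ε - (g + r) * ζ) =
        g * (ρ * a + ρ * (ε / (g + r)) - ρ * ζ) := by
      field_simp
    have h6 : s < ε / (g + r) := (lt_div_iff₀ hh).2 hsε
    have h7 : g * ∑ v ∈ R \ bad, z v ≤ g * (a * ρ) := mul_le_mul_of_nonneg_left hsum₁ hg.le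
    have h8 : g * (#bad * ζ) ≤ g * (s * ρ) := mul_le_mul_of_nonneg_left hbadζ hg.le
    have h9 : g * (s * ρ) < g * (ρ * (ε / (g + r))) :=
      mul_lt_mul_of_pos_left (by nlinarith) hg
    rw [h5] at h4
    nlinarith
  · have h1 : #(R \ bad) * ζ ≤ ∑ v ∈ R \ bad, z v := by
      rw [← nsmul_eq_mul]
      exact Finset.card_nsmul_le_sum _ _ _ hmin
    rw [hcard] at h1
    have h2 : (g + r) * (ρ * ζ) ≤ (g + r) * (s * ρ + a * ρ) :=
      mul_le_mul_of_nonneg_left (by linarith) hh.le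
    have h3 := mul_le_mul_of_nonneg_right hle hρ.le
    have h4 := mul_lt_mul_of_pos_right hsε hρ
    linarith

variable {h : ℕ} {H : SimpleGraph (Fin h)} {g r : ℕ}

open Classical in
lemma exists_light_copy (hH : IsSplit H g r) (hg : 0 < g) {η ε γ : ℝ} (hη : 0 < η) (hε : 0 < ε)
    (hγ : 0 < γ) :
    ∃ n₀ : ℕ, ∀ n ≥ n₀, ∀ (G : SimpleGraph (Fin n)) (R : Finset (Fin n)), γ * n ≤ #R →
      (∀ v ∈ R, ((g : ℝ) / h + η) * #R ≤ #{w ∈ R | G.Adj v w}) → ∀ z : Fin n → ℝ,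
      (∀ v, 0 ≤ z v) → (∀ v, z v ≤ 1) → ∃ e ⊆ R, IsCopySet H G e ∧
        ∑ v ∈ e, z v ≤ h * ((∑ v ∈ R, z v) / #R) + ε := by
  have hgr := hH.add_eq
  have hlt := hH.lt
  have hgrR : (g : ℝ) + r = h := by exact_mod_cast hgr
  have hhR : (0 : ℝ) < h := by exact_mod_cast (by omega : 0 < h)
  obtain ⟨s, hs0, hs₁, hs₂, hs₃⟩ : ∃ s : ℝ, 0 < s ∧ s ≤ 1 / 2 ∧ s ≤ η / 2 ∧ s ≤ ε / (2 * h) :=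
    ⟨min (1 / 2) (min (η / 2) (ε / (2 * h))), by positivity, min_le_left ..,
      (min_le_right ..).trans (min_le_left ..), (min_le_right ..).trans (min_le_right ..)⟩
  rw [le_div_iff₀ (by positivity)] at hs₃
  obtain ⟨ρ, hρ, n₀, hn₀⟩ := exists_card_blowup_ge h (δ := (s * γ) ^ 2 / 2) (by positivity)
  refine ⟨max n₀ 1, fun n hn G R hR hdeg z hz₀ hz₁ ↦ ?_⟩
  have hn1 : (0 : ℝ) < n := by exact_mod_cast (le_max_right n₀ 1).trans hn
  have hRne : R.Nonempty :=
    Finset.card_pos.1 (by exact_mod_cast (by positivity : 0 < γ * n).trans_le hR)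
  set t : ℝ := h * ((∑ v ∈ R, z v) / #R) + ε with ht
  have hpairs := card_light_pairs_ge (R := R) (adj := G.Adj) (z := z) (g := g) (r := r) (η := η)
    (ε := ε) (s := s) (by exact_mod_cast hg) (by positivity) hs0 (by linarith) (by linarith)
    (by rw [hgrR]; nlinarith) hRne hz₀ hz₁ (by rwa [hgrR])
  rw [hgrR, ← ht] at hpairs
  set P : Fin n → Fin n → Prop := fun u v ↦
    u ∈ R ∧ v ∈ R ∧ G.Adj u v ∧ r * z u + g * z v ≤ t with hP
  have hsγ : (s * γ) ^ 2 * n ^ 2 ≤ s ^ 2 * #R ^ 2 := by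
    rw [mul_pow, mul_assoc, ← mul_pow]
    exact mul_le_mul_of_nonneg_left (pow_le_pow_left₀ (by positivity) hR 2) (by positivity)
  have hle : #{p ∈ R ×ˢ R | G.Adj p.1 p.2 ∧ r * z p.1 + g * z p.2 ≤ t} ≤
      #{p : Fin n × Fin n | p.1 < p.2 ∧ P p.1 p.2} +
        #{p : Fin n × Fin n | p.1 < p.2 ∧ P p.2 p.1} := by
    rw [← Finset.card_map (Equiv.prodComm _ _).toEmbedding
      (s := {p : Fin n × Fin n | p.1 < p.2 ∧ P p.2 p.1})]
    refine (Finset.card_le_card fun p hp ↦ ?_).trans (Finset.card_union_le ..)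
    simp only [Finset.mem_filter, Finset.mem_product, Finset.mem_union, Finset.mem_univ, true_and,
      Finset.mem_map_equiv, hP] at hp ⊢
    rcases lt_or_gt_of_ne hp.2.1.ne with h | h
    · exact .inl ⟨h, hp.1.1, hp.1.2, hp.2⟩
    · exact .inr ⟨h, hp.1.1, hp.1.2, hp.2⟩
  have hle' : (#{p ∈ R ×ˢ R | G.Adj p.1 p.2 ∧ r * z p.1 + g * z p.2 ≤ t} : ℝ) ≤
      #{p : Fin n × Fin n | p.1 < p.2 ∧ P p.1 p.2} +
        #{p : Fin n × Fin n | p.1 < p.2 ∧ P p.2 p.1} := by exact_mod_cast hle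
  have blow (P' : Fin n → Fin n → Prop)
      (hP' : (s * γ) ^ 2 / 2 * n ^ 2 ≤ #{p : Fin n × Fin n | P' p.1 p.2}) :
      ∃ A B : Finset (Fin n), #A = h ∧ #B = h ∧ ∀ a ∈ A, ∀ b ∈ B, P' a b := by
    have h1 := hn₀ n ((le_max_left _ _).trans hn) P' ∅ hP' (by simp; positivity)
    have h2 : (0 : ℝ) < ((s * γ) ^ 2 / 2) ^ (h * h) / 2 * ((n : ℝ) ^ h * n ^ h) := by positivity
    obtain ⟨q, hq⟩ := Finset.card_pos.1 (Nat.cast_pos.1 (h2.trans_le h1))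
    simp only [Finset.mem_filter, Finset.mem_univ, true_and] at hq
    obtain ⟨⟨hi₁, -⟩, ⟨hi₂, -⟩, hq⟩ := hq
    refine ⟨univ.image q.1, univ.image q.2, ?_, ?_, by simpa using hq⟩
    · rw [Finset.card_image_of_injective _ hi₁]; simp
    · rw [Finset.card_image_of_injective _ hi₂]; simp
  have fin {A B : Finset (Fin n)} (cA : #A = r) (cB : #B = g) (hAB : ∀ a ∈ A, ∀ b ∈ B, P a b)
      (hd : Disjoint A B) : A ∪ B ⊆ R ∧ ∑ v ∈ A ∪ B, z v ≤ t := by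
    obtain ⟨a, ha, hamax⟩ := Finset.exists_max_image A z (Finset.card_pos.1 (by omega))
    obtain ⟨b, hb, hbmax⟩ := Finset.exists_max_image B z (Finset.card_pos.1 (by omega))
    refine ⟨Finset.union_subset (fun v hv ↦ (hAB v hv b hb).1)
      (fun v hv ↦ (hAB a ha v hv).2.1), ?_⟩
    rw [Finset.sum_union hd]
    have h1 := Finset.sum_le_card_nsmul A z _ hamax
    have h2 := Finset.sum_le_card_nsmul B z _ hbmax
    rw [nsmul_eq_mul] at h1 h2
    rw [cA] at h1
    rw [cB] at h2
    linarith [(hAB a ha b hb).2.2.2]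
  rcases le_total ((s * γ) ^ 2 / 2 * n ^ 2)
    (#{p : Fin n × Fin n | p.1 < p.2 ∧ P p.1 p.2} : ℝ) with hcase | hcase
  · obtain ⟨A, B, cA, cB, hAB⟩ := blow (fun a b ↦ a < b ∧ P a b) 
      (hcase.trans (le_of_eq (by congr!)))
    obtain ⟨A', hA', cA'⟩ := Finset.exists_subset_card_eq (s := A) (n := r) (by omega)
    obtain ⟨B', hB', cB'⟩ := Finset.exists_subset_card_eq (s := B) (n := g) (by omega)
    have hc : CompletePair G A' B' := fun a ha b hb ↦
      ⟨(hAB a (hA' ha) b (hB' hb)).1, (hAB a (hA' ha) b (hB' hb)).2.2.2.1⟩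
    obtain ⟨h1, h2⟩ := fin cA' cB' (fun a ha b hb ↦ (hAB a (hA' ha) b (hB' hb)).2) hc.disjoint
    exact ⟨A' ∪ B', h1, hc.isCopySet hH (by omega) (by omega) (by omega), h2⟩
  · obtain ⟨B, A, cB, cA, hAB⟩ := blow (fun a b ↦ a < b ∧ P b a) (by
      refine le_trans (b := (#{p : Fin n × Fin n | p.1 < p.2 ∧ P p.2 p.1} : ℝ)) (by linarith) ?_
      exact le_of_eq (by congr!))
    obtain ⟨A', hA', cA'⟩ := Finset.exists_subset_card_eq (s := A) (n := r) (by omega)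
    obtain ⟨B', hB', cB'⟩ := Finset.exists_subset_card_eq (s := B) (n := g) (by omega)
    have hc : CompletePair G B' A' := fun b hb a ha ↦
      ⟨(hAB b (hB' hb) a (hA' ha)).1, (hAB b (hB' hb) a (hA' ha)).2.2.2.1.symm⟩
    obtain ⟨h1, h2⟩ := fin cA' cB' (fun a ha b hb ↦ (hAB b (hB' hb) a (hA' ha)).2)
      hc.disjoint.symm
    refine ⟨A' ∪ B', h1, ?_, h2⟩
    rw [Finset.union_comm]
    exact hc.isCopySet hH (by omega) (by omega) (by omega)

end LightCopy

section Almost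

open Real in
lemma exp_step {lam ρ k D h : ℝ} (hlam : 0 ≤ lam) (hh : 0 < h) (hρ : 2 * h ≤ ρ)
    (hlamρ : lam * (2 * h) ≤ ρ) (hk₀ : 0 ≤ k) (hk : k ≤ h) (hD₀ : 0 ≤ D) (hD : D ≤ ρ) :
    exp (-(lam * ((D - k) / (ρ - h)))) ≤
      exp (-(lam * (D / ρ))) *
        (1 + lam / (ρ - h) * (k - h * (D / ρ)) + 4 * lam ^ 2 * h ^ 2 / ρ ^ 2) := by
  have hρ0 : 0 < ρ := by linarith
  have hρh : 0 < ρ - h := by linarith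
  obtain ⟨d, hd⟩ : ∃ d, d = D / ρ := ⟨_, rfl⟩
  have hd₀ : 0 ≤ d := hd ▸ by positivity
  have hd₁ : d ≤ 1 := hd ▸ (div_le_one hρ0).2 hD
  have hDd : D = d * ρ := by rw [hd, div_mul_cancel₀ _ hρ0.ne']
  rw [← hd]
  obtain ⟨x, hx⟩ : ∃ x, x = lam / (ρ - h) * (k - h * d) := ⟨_, rfl⟩
  have e : -(lam * ((D - k) / (ρ - h))) = -(lam * d) + x := by
    rw [hx, hDd]
    field_simp
    ring
  have h1 : |k - h * d| ≤ h := by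
    rw [abs_le]
    constructor <;> nlinarith
  have h2 : |x| ≤ lam * (2 * h) / ρ := by
    rw [hx, abs_mul, abs_of_nonneg (by positivity)]
    calc lam / (ρ - h) * |k - h * d| ≤ lam / (ρ - h) * h :=
          mul_le_mul_of_nonneg_left h1 (by positivity)
      _ ≤ lam * (2 * h) / ρ := by
          rw [div_mul_eq_mul_div, div_le_div_iff₀ hρh hρ0]
          nlinarith [mul_nonneg hlam hh.le]
  have h3 : |x| ≤ 1 := h2.trans ((div_le_one hρ0).2 hlamρ)
  have h4 : exp x ≤ 1 + x + x ^ 2 := by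
    linarith [(abs_le.1 (Real.abs_exp_sub_one_sub_id_le h3)).2]
  have h5 : x ^ 2 ≤ 4 * lam ^ 2 * h ^ 2 / ρ ^ 2 := by
    rw [← sq_abs]
    refine (pow_le_pow_left₀ (abs_nonneg x) h2 2).trans_eq ?_
    rw [div_pow]
    ring
  rw [e, exp_add, ← hx]
  exact mul_le_mul_of_nonneg_left (by linarith) (exp_pos _).le

open Classical in
/-- The potential controlling the relative degrees into `R` of the vertices of `R₀`. -/
noncomputable def degPotential {n : ℕ} (G : SimpleGraph (Fin n)) (lam : ℝ)
    (R₀ R : Finset (Fin n)) : ℝ :=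
  ∑ v ∈ R₀, Real.exp (-(lam * ((#{w ∈ R | G.Adj v w} : ℝ) / #R)))

open Classical in
lemma degPotential_sdiff_le {n h : ℕ} {G : SimpleGraph (Fin n)} {lam ε : ℝ}
    {R₀ R e : Finset (Fin n)} (hlam : 0 ≤ lam) (hε : 0 ≤ ε) (hh : 0 < h) (hρ : 2 * h ≤ #R)
    (hlamρ : lam * (2 * h) ≤ #R) (heR : e ⊆ R) (he : #e = h)
    (hlight : ∑ v ∈ R₀, Real.exp (-(lam * ((#{w ∈ R | G.Adj v w} : ℝ) / #R))) *
        #{w ∈ e | G.Adj v w} ≤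
      h * ∑ v ∈ R₀, Real.exp (-(lam * ((#{w ∈ R | G.Adj v w} : ℝ) / #R))) *
        ((#{w ∈ R | G.Adj v w} : ℝ) / #R) + ε * degPotential G lam R₀ R) :
    degPotential G lam R₀ (R \ e) ≤
      degPotential G lam R₀ R * (1 + 2 * lam * ε / #R + 4 * lam ^ 2 * h ^ 2 / #R ^ 2) := by
  have hhR : (0 : ℝ) < h := Nat.cast_pos.2 hh
  have hρR : (2 * h : ℝ) ≤ #R := by exact_mod_cast hρ
  have hρ0 : (0 : ℝ) < #R := by linarith
  have hcard : (#(R \ e) : ℝ) = #R - h := by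
    rw [Finset.card_sdiff_of_subset heR, he, Nat.cast_sub (by omega)]
  have hfilter (v : Fin n) : (#{w ∈ R \ e | G.Adj v w} : ℝ) =
      #{w ∈ R | G.Adj v w} - #{w ∈ e | G.Adj v w} := by
    have hsub : ({w ∈ e | G.Adj v w} : Finset (Fin n)) ⊆ {w ∈ R | G.Adj v w} :=
      Finset.filter_subset_filter _ heR
    have heq : ({w ∈ R \ e | G.Adj v w} : Finset (Fin n)) =
        {w ∈ R | G.Adj v w} \ {w ∈ e | G.Adj v w} := by
      ext w
      simp only [Finset.mem_filter, Finset.mem_sdiff]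
      tauto
    rw [heq, Finset.card_sdiff_of_subset hsub, Nat.cast_sub (Finset.card_le_card hsub)]
  obtain ⟨w, hw⟩ : ∃ w : Fin n → ℝ, ∀ v, w v =
    Real.exp (-(lam * ((#{w ∈ R | G.Adj v w} : ℝ) / #R))) := ⟨_, fun _ ↦ rfl⟩
  have hΦ : degPotential G lam R₀ R = ∑ v ∈ R₀, w v := by simp only [degPotential, hw]
  simp only [← hw] at hlight
  have hw0 : 0 ≤ ∑ v ∈ R₀, w v :=
    Finset.sum_nonneg fun v _ ↦ hw v ▸ (Real.exp_pos _).le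
  have h1 : degPotential G lam R₀ (R \ e) ≤ ∑ v ∈ R₀, w v * (1 + lam / (#R - h) *
      (#{w ∈ e | G.Adj v w} - h * ((#{w ∈ R | G.Adj v w} : ℝ) / #R)) +
        4 * lam ^ 2 * h ^ 2 / #R ^ 2) := by
    refine Finset.sum_le_sum fun v _ ↦ ?_
    rw [hcard, hfilter, hw]
    refine exp_step hlam hhR hρR hlamρ (Nat.cast_nonneg _) ?_ (Nat.cast_nonneg _) ?_
    · exact Nat.cast_le.2 (he ▸ Finset.card_filter_le ..)
    · exact Nat.cast_le.2 (Finset.card_filter_le ..)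
  have h2 : ∑ v ∈ R₀, w v * (1 + lam / (#R - h) *
      (#{w ∈ e | G.Adj v w} - h * ((#{w ∈ R | G.Adj v w} : ℝ) / #R)) +
        4 * lam ^ 2 * h ^ 2 / #R ^ 2) =
      (∑ v ∈ R₀, w v) * (1 + 4 * lam ^ 2 * h ^ 2 / #R ^ 2) + lam / (#R - h) *
        (∑ v ∈ R₀, w v * #{w ∈ e | G.Adj v w} -
          h * ∑ v ∈ R₀, w v * ((#{w ∈ R | G.Adj v w} : ℝ) / #R)) := by
    rw [Finset.mul_sum, ← Finset.sum_sub_distrib, Finset.mul_sum, Finset.sum_mul,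
      ← Finset.sum_add_distrib]
    exact Finset.sum_congr rfl fun v _ ↦ by ring
  have h3 : lam / (#R - h) ≤ 2 * lam / #R := by
    rw [div_le_div_iff₀ (by linarith) hρ0]
    nlinarith
  rw [hΦ] at hlight ⊢
  have h4 : lam / (#R - h) * (∑ v ∈ R₀, w v * #{w ∈ e | G.Adj v w} -
      h * ∑ v ∈ R₀, w v * ((#{w ∈ R | G.Adj v w} : ℝ) / #R)) ≤
        2 * lam / #R * (ε * ∑ v ∈ R₀, w v) :=
    (mul_le_mul_of_nonneg_left (by linarith)
      (div_nonneg hlam (by linarith))).trans (mul_le_mul_of_nonneg_right h3 (by positivity))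
  refine (h1.trans_eq h2).trans ((add_le_add_right h4 _).trans_eq ?_)
  ring

lemma IsCopySet.card_eq {h n : ℕ} {H : SimpleGraph (Fin h)} {G : SimpleGraph (Fin n)}
    {e : Finset (Fin n)} (he : IsCopySet H G e) : #e = h := by
  obtain ⟨φ, hφ, rfl⟩ := he
  rw [Finset.card_image_of_injective _ hφ.1.injective, Finset.card_univ, Fintype.card_fin]

open Classical in
lemma exists_degPotential_sdiff_le {h g r : ℕ} {H : SimpleGraph (Fin h)} (hH : IsSplit H g r)
    (hg : 0 < g) {η ε γ : ℝ} (hη : 0 < η) (hε : 0 < ε) (hγ : 0 < γ) :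
    ∃ n₀ : ℕ, ∀ n : ℕ, n₀ ≤ n → ∀ (G : SimpleGraph (Fin n)) (R₀ R : Finset (Fin n)) (lam : ℝ),
      γ * n ≤ #R → 2 * h ≤ #R → 0 ≤ lam → lam * (2 * h) ≤ #R → R ⊆ R₀ →
      (∀ v ∈ R, ((g : ℝ) / h + η) * #R ≤ #{w ∈ R | G.Adj v w}) →
      ∃ e ⊆ R, IsCopySet H G e ∧ degPotential G lam R₀ (R \ e) ≤
        degPotential G lam R₀ R * (1 + 2 * lam * ε / #R + 4 * lam ^ 2 * h ^ 2 / #R ^ 2) := by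
  have hh : 0 < h := by have := hH.add_eq; omega
  obtain ⟨n₀, hn₀⟩ := exists_light_copy hH hg hη hε hγ
  refine ⟨n₀, fun n hn G R₀ R lam hR hR₂ hlam hlamR hRR hdeg ↦ ?_⟩
  obtain ⟨w, hw⟩ : ∃ w : Fin n → ℝ, ∀ v, w v =
    Real.exp (-(lam * ((#{w ∈ R | G.Adj v w} : ℝ) / #R))) := ⟨_, fun _ ↦ rfl⟩
  obtain ⟨W, hW⟩ : ∃ W, W = ∑ v ∈ R₀, w v := ⟨_, rfl⟩
  have hΦ : degPotential G lam R₀ R = W := by simp only [degPotential, hw, hW]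
  have hw0 (v : Fin n) : 0 < w v := hw v ▸ Real.exp_pos _
  have hne : R₀.Nonempty :=
    (Finset.card_pos.1 (by omega : 0 < #R)).mono hRR
  have hW0 : 0 < W := hW ▸ Finset.sum_pos (fun v _ ↦ hw0 v) hne
  have key (S : Finset (Fin n)) :
      ∑ u ∈ S, (∑ v ∈ R₀ with G.Adj v u, w v) = ∑ v ∈ R₀, w v * #{u ∈ S | G.Adj v u} := by
    simp only [Finset.sum_filter]
    rw [Finset.sum_comm]
    refine Finset.sum_congr rfl fun v _ ↦ ?_
    rw [← Finset.sum_filter, Finset.sum_const, nsmul_eq_mul, mul_comm]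
  obtain ⟨e, heR, he, hlight⟩ := hn₀ n hn G R hR hdeg
    (fun u ↦ (∑ v ∈ R₀ with G.Adj v u, w v) / W)
    (fun u ↦ div_nonneg (Finset.sum_nonneg fun v _ ↦ (hw0 v).le) hW0.le)
    (fun u ↦ div_le_one_of_le₀ (hW ▸ Finset.sum_le_sum_of_subset_of_nonneg
      (Finset.filter_subset _ _) fun v _ _ ↦ (hw0 v).le) hW0.le)
  refine ⟨e, heR, he, degPotential_sdiff_le hlam hε.le hh hR₂ hlamR heR he.card_eq ?_⟩
  simp only [← Finset.sum_div, key] at hlight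
  simp only [← hw]
  rw [hΦ]
  rw [div_le_iff₀ hW0] at hlight
  refine hlight.trans_eq ?_
  rw [add_mul, div_div, mul_assoc, div_mul_eq_mul_div, mul_comm W, mul_div_mul_right _ _ hW0.ne',
    Finset.sum_div]
  simp only [mul_div_assoc]

end Almost

section AlmostTiling

open Real in
lemma sub_le_of_exp_neg_le {θ ξ η n d d₀ : ℝ} {k : ℕ} (hθ : 0 < θ) (hξ : 0 ≤ ξ) (hn : 0 < n)
    (hk : k ≤ n) (hlog : log n ≤ θ * η / 4 * n) (hξη : ξ ≤ θ * η / 4)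
    (hd : exp (-(θ * n * d)) ≤ n * exp (-(θ * n * d₀)) * (1 + ξ) ^ k) :
    d₀ - η / 2 ≤ d := by
  have h1 : (1 + ξ) ^ k ≤ exp (ξ * n) := by
    calc (1 + ξ) ^ k ≤ exp ξ ^ k :=
          pow_le_pow_left₀ (by linarith) (by linarith [add_one_le_exp ξ]) k
      _ = exp (ξ * k) := by rw [← exp_nat_mul, mul_comm]
      _ ≤ exp (ξ * n) := exp_le_exp.2 (mul_le_mul_of_nonneg_left hk hξ)
  have h2 : exp (-(θ * n * d)) ≤ exp (log n + -(θ * n * d₀) + ξ * n) := by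
    rw [exp_add, exp_add, exp_log hn]
    exact hd.trans (mul_le_mul_of_nonneg_left h1 (by positivity))
  have h3 := exp_le_exp.1 h2
  have h4 : ξ * n ≤ θ * η / 4 * n := mul_le_mul_of_nonneg_right hξη hn.le
  have h5 : θ * n * (d₀ - η / 2) ≤ θ * n * d := by linarith
  exact le_of_mul_le_mul_left h5 (by positivity)

open Classical in
lemma degPotential_self_le {n : ℕ} {G : SimpleGraph (Fin n)} {R₀ : Finset (Fin n)} {lam d : ℝ}
    (hlam : 0 ≤ lam) (hdeg : ∀ v ∈ R₀, d * #R₀ ≤ #{w ∈ R₀ | G.Adj v w}) :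
    degPotential G lam R₀ R₀ ≤ n * Real.exp (-(lam * d)) := by
  have h1 : degPotential G lam R₀ R₀ ≤ ∑ _v ∈ R₀, Real.exp (-(lam * d)) := by
    refine Finset.sum_le_sum fun v hv ↦ Real.exp_le_exp.2 (neg_le_neg ?_)
    have : (0 : ℝ) < #R₀ := Nat.cast_pos.2 (Finset.card_pos.2 ⟨v, hv⟩)
    exact mul_le_mul_of_nonneg_left ((le_div_iff₀ this).2 (hdeg v hv)) hlam
  rw [Finset.sum_const, nsmul_eq_mul] at h1
  have h2 : (#R₀ : ℝ) ≤ n := Nat.cast_le.2 (R₀.card_le_univ.trans_eq (Fintype.card_fin n))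
  exact h1.trans (mul_le_mul_of_nonneg_right h2 (Real.exp_pos _).le)

open Classical in
lemma exists_tiling_sdiff_card_le {h g r : ℕ} {H : SimpleGraph (Fin h)} (hH : IsSplit H g r)
    (hg : 0 < g) {η γ : ℝ} (hη : 0 < η) (hγ : 0 < γ) :
    ∃ n₀ : ℕ, ∀ n : ℕ, n₀ ≤ n → ∀ (G : SimpleGraph (Fin n)) (R₀ : Finset (Fin n)),
      (∀ v ∈ R₀, ((g : ℝ) / h + η) * #R₀ ≤ #{w ∈ R₀ | G.Adj v w}) →
      ∃ R ⊆ R₀, #R ≤ γ * n ∧ HasPerfectTilingOn H G (R₀ \ R) := by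
  have hh : 0 < h := by have := hH.add_eq; omega
  have hhR : (0 : ℝ) < h := Nat.cast_pos.2 hh
  obtain ⟨ε, hε⟩ : ∃ ε, ε = η * γ / 16 := ⟨_, rfl⟩
  obtain ⟨θ, hθ⟩ : ∃ θ, θ = min (η * γ ^ 2 / (32 * h ^ 2)) (γ / (2 * h)) := ⟨_, rfl⟩
  have hε0 : 0 < ε := hε ▸ by positivity
  have hθ0 : 0 < θ := hθ ▸ by positivity
  have hθ₁ : θ * (32 * h ^ 2) ≤ η * γ ^ 2 :=
    (le_div_iff₀ (by positivity)).1 (hθ ▸ min_le_left ..)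
  have hθ₂ : θ * (2 * h) ≤ γ := (le_div_iff₀ (by positivity)).1 (hθ ▸ min_le_right ..)
  obtain ⟨ξ, hξ⟩ : ∃ ξ, ξ = 2 * θ * ε / γ + 4 * θ ^ 2 * h ^ 2 / γ ^ 2 := ⟨_, rfl⟩
  have hξ0 : 0 ≤ ξ := hξ ▸ by positivity
  have hξη : ξ ≤ θ * η / 4 := by
    have h1 : 2 * θ * ε / γ = θ * η / 8 := by rw [hε]; field_simp; ring
    have h2 : 4 * θ ^ 2 * h ^ 2 / γ ^ 2 ≤ θ * η / 8 := by
      rw [div_le_iff₀ (by positivity)]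
      nlinarith
    linarith
  obtain ⟨n₁, hn₁⟩ := exists_degPotential_sdiff_le hH hg (half_pos hη) hε0 hγ
  obtain ⟨n₂, hn₂⟩ := exists_nat_ge (2 * h / γ)
  obtain ⟨n₃, hn₃⟩ : ∃ n₃ : ℕ, ∀ n : ℕ, n₃ ≤ n → Real.log n ≤ θ * η / 4 * n := by
    have := (Real.isLittleO_log_id_atTop.comp_tendsto tendsto_natCast_atTop_atTop).bound
      (show 0 < θ * η / 4 by positivity)
    obtain ⟨n₃, hn₃⟩ := Filter.eventually_atTop.1 this
    refine ⟨n₃, fun n hn ↦ (le_abs_self _).trans ?_⟩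
    simpa using hn₃ n hn
  refine ⟨max (max n₁ n₂) (max n₃ 1), fun n hn G R₀ hdeg ↦ ?_⟩
  simp only [max_le_iff] at hn
  obtain ⟨⟨hn1, hn2⟩, hn3, hn4⟩ := hn
  have hn0 : (0 : ℝ) < n := Nat.cast_pos.2 hn4
  have hγn : 2 * h ≤ γ * n := by
    have := (div_le_iff₀ hγ).1 (hn₂.trans (Nat.cast_le.2 hn2))
    linarith
  by_contra! hcon
  have hstep (k : ℕ) : ∃ R ⊆ R₀, #R + h * k = #R₀ ∧ HasPerfectTilingOn H G (R₀ \ R) ∧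
      degPotential G (θ * n) R₀ R ≤
        n * Real.exp (-(θ * n * ((g : ℝ) / h + η))) * (1 + ξ) ^ k := by
    induction k with
    | zero =>
      refine ⟨R₀, subset_rfl, by simp, by simpa using HasPerfectTilingOn.empty, ?_⟩
      simpa using degPotential_self_le (by positivity) hdeg
    | succ k ih =>
      obtain ⟨R, hR, hk, htil, hpot⟩ := ih
      have hRγ : γ * n < #R := by
        by_contra! hle
        exact hcon R hR hle htil
      have hR0 : (0 : ℝ) < #R := by linarith
      have hkn : (k : ℝ) ≤ n := by
        have h1 : #R₀ ≤ n := R₀.card_le_univ.trans_eq (Fintype.card_fin n)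
        exact Nat.cast_le.2 (by nlinarith)
      have hdeg' : ∀ v ∈ R, ((g : ℝ) / h + η / 2) * #R ≤ #{w ∈ R | G.Adj v w} := by
        intro v hv
        rw [← le_div_iff₀ hR0]
        have h1 : Real.exp (-(θ * n * ((#{w ∈ R | G.Adj v w} : ℝ) / #R))) ≤
            degPotential G (θ * n) R₀ R :=
          Finset.single_le_sum (f := fun v ↦
            Real.exp (-(θ * n * ((#{w ∈ R | G.Adj v w} : ℝ) / #R))))
            (fun v _ ↦ (Real.exp_pos _).le) (hR hv)
        have := sub_le_of_exp_neg_le hθ0 hξ0 hn0 hkn (hn₃ n hn3) hξη (h1.trans hpot)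
        linarith
      obtain ⟨e, heR, he, hpot'⟩ := hn₁ n hn1 G R₀ R (θ * n) hRγ.le
        (by exact_mod_cast hγn.trans hRγ.le) (by positivity) (by nlinarith) hR hdeg'
      refine ⟨R \ e, Finset.sdiff_subset.trans hR, ?_, ?_, ?_⟩
      · have h1 := Finset.card_sdiff_add_card_eq_card heR
        rw [he.card_eq] at h1
        linarith
      · have h1 : R₀ \ (R \ e) = R₀ \ R ∪ e := by
          ext x
          have h2 := @hR x
          have h3 := @heR x
          simp only [Finset.mem_sdiff, Finset.mem_union]
          tauto
        rw [h1]
        exact htil.union he.hasPerfectTilingOn (Finset.disjoint_of_subset_right heR Finset.sdiff_disjoint)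
      · have h1 : 2 * (θ * n) * ε / #R ≤ 2 * θ * ε / γ := by
          rw [div_le_div_iff₀ hR0 hγ]
          have : 0 ≤ 2 * θ * ε := by positivity
          nlinarith
        have h2 : 4 * (θ * n) ^ 2 * h ^ 2 / (#R : ℝ) ^ 2 ≤ 4 * θ ^ 2 * h ^ 2 / γ ^ 2 := by
          rw [div_le_div_iff₀ (by positivity) (by positivity)]
          have h3 : (γ * n) ^ 2 ≤ (#R : ℝ) ^ 2 := pow_le_pow_left₀ (by positivity) hRγ.le 2
          have h4 : 0 ≤ 4 * θ ^ 2 * (h : ℝ) ^ 2 := by positivity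
          calc 4 * (θ * n) ^ 2 * h ^ 2 * γ ^ 2 = 4 * θ ^ 2 * h ^ 2 * (γ * n) ^ 2 := by ring
            _ ≤ _ := mul_le_mul_of_nonneg_left h3 h4
        have h5 : 0 ≤ degPotential G (θ * n) R₀ R :=
          Finset.sum_nonneg fun v _ ↦ (Real.exp_pos _).le
        rw [pow_succ, ← mul_assoc]
        exact hpot'.trans (mul_le_mul hpot (by linarith) (by positivity) (h5.trans hpot))
  obtain ⟨R, -, hR, -⟩ := hstep (#R₀ + 1)
  nlinarith

end AlmostTiling

section AbsorbingSet

variable {h n g r : ℕ} {H : SimpleGraph (Fin h)} {G : SimpleGraph (Fin n)}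

lemma HasPerfectTilingOn.dvd_card {S : Finset (Fin n)} (hS : HasPerfectTilingOn H G S) :
    h ∣ #S := by
  obtain ⟨𝒯, h₁, h₂, rfl⟩ := hS
  rw [Finset.card_biUnion h₂]
  exact Finset.dvd_sum fun T hT ↦ dvd_of_eq (h₁ T hT).card_eq.symm

lemma le_of_half_pow_le {β : ℝ} {M N c : ℕ} (hn : 0 < n) (hβ : β ≤ 1) (hlog : Real.log n ≤ M)
    (hM : 4 * M ≤ β * N) (hc : (1 / 2 : ℝ) ^ c ≤ n * (1 - β / 2) ^ N) : M ≤ c := by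
  have hn0 : (0 : ℝ) < n := Nat.cast_pos.2 hn
  have h1 : (1 - β / 2) ^ N ≤ Real.exp (-(2 * M)) := by
    calc (1 - β / 2) ^ N ≤ Real.exp (-(β / 2)) ^ N :=
          pow_le_pow_left₀ (by linarith) (by linarith [Real.add_one_le_exp (-(β / 2))]) N
      _ = Real.exp (N * -(β / 2)) := by rw [← Real.exp_nat_mul]
      _ ≤ _ := Real.exp_le_exp.2 (by linarith)
  have h2 : (1 / 2 : ℝ) ^ c ≤ (1 / 2) ^ M := by
    calc (1 / 2 : ℝ) ^ c ≤ Real.exp M * Real.exp (-(2 * M)) := by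
          refine hc.trans (mul_le_mul ?_ h1 (pow_nonneg (by linarith) N) (Real.exp_pos _).le)
          rwa [← Real.log_le_iff_le_exp hn0]
      _ = Real.exp (-1) ^ M := by
          rw [← Real.exp_add, ← Real.exp_nat_mul]
          congr 1
          ring
      _ ≤ (1 / 2) ^ M := by
          refine pow_le_pow_left₀ (Real.exp_pos _).le ?_ M
          rw [Real.exp_neg, one_div]
          exact inv_anti₀ (by norm_num) (by linarith [Real.add_one_le_exp (1 : ℝ)])
  exact (pow_le_pow_iff_right_of_lt_one₀ (by norm_num) (by norm_num)).1 h2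

/-- The vertex set of the gadget given by a pair of vertex sequences. -/
def gadgetSet {m : ℕ} (q : (Fin m → Fin n) × (Fin m → Fin n)) : Finset (Fin n) :=
  univ.image q.1 ∪ univ.image q.2

lemma gadgetSet_card_le {m : ℕ} (q : (Fin m → Fin n) × (Fin m → Fin n)) :
    #(gadgetSet q) ≤ 2 * m := by
  rw [gadgetSet, two_mul]
  refine (Finset.card_union_le _ _).trans (Nat.add_le_add ?_ ?_) <;>
    exact Finset.card_image_le.trans_eq (by simp)

/-- A gadget fitting `x`. -/
def IsGadgetFor (G : SimpleGraph (Fin n)) {m : ℕ} (x : Fin n)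
    (q : (Fin m → Fin n) × (Fin m → Fin n)) : Prop :=
  q.1.Injective ∧ q.2.Injective ∧ CompletePair G (univ.image q.1) (univ.image q.2) ∧
    Fits G x (univ.image q.1) (univ.image q.2)

open Classical in
lemma exists_card_isGadgetFor_ge {m : ℕ} (hm : 0 < m) {η : ℝ} (hη : 0 < η) :
    ∃ β : ℝ, 0 < β ∧ ∃ ρ : ℝ, 0 < ρ ∧ ∃ n₀ : ℕ, ∀ n ≥ n₀, ∀ G : SimpleGraph (Fin n),
      (∀ v, η * n ≤ odeg G v) → ∀ (x : Fin n) (U : Finset (Fin n)), #U ≤ ρ * n →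
      β * Fintype.card ((Fin m → Fin n) × (Fin m → Fin n)) ≤
        #{q : (Fin m → Fin n) × (Fin m → Fin n) |
          IsGadgetFor G x q ∧ Disjoint (gadgetSet q) U} := by
  obtain ⟨β, hβ, ρ, hρ, n₀, hn₀⟩ := exists_card_fits_ge m hm hη
  refine ⟨β, hβ, ρ, hρ, n₀, fun n hn G hdeg x U hU ↦ ?_⟩
  have h1 : (Fintype.card ((Fin m → Fin n) × (Fin m → Fin n)) : ℝ) = (n : ℝ) ^ m * n ^ m := by
    simp
  rw [h1]
  refine (hn₀ n hn G hdeg x U hU).trans (Nat.cast_le.2 (Finset.card_le_card fun q hq ↦ ?_))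
  rw [Finset.mem_filter] at hq ⊢
  exact hq

open Classical in
lemma exists_gadget_family {m : ℕ} (hm : 0 < m) (hh : 0 < h) {η : ℝ} (hη : 0 < η) :
    ∃ γ : ℝ, 0 < γ ∧ ∃ n₀ : ℕ, ∀ n ≥ n₀, ∀ G : SimpleGraph (Fin n), (∀ v, η * n ≤ odeg G v) →
      ∃ (M N : ℕ) (Y : Finset (Fin n)) (F : Finset ((Fin m → Fin n) × (Fin m → Fin n))),
        γ * n ≤ M ∧ h * M ≤ N ∧ #Y = (h - 1) * M ∧ #F = N ∧
        ((#Y + 2 * m * N : ℕ) : ℝ) ≤ η / 2 * n ∧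
        (F : Set ((Fin m → Fin n) × (Fin m → Fin n))).PairwiseDisjoint gadgetSet ∧
        (∀ q ∈ F, ∀ y ∈ Y, ∀ v ∈ gadgetSet q, y < v) ∧ (∀ q ∈ F, ∃ x, IsGadgetFor G x q) ∧
        ∀ x, M ≤ #{q ∈ F | IsGadgetFor G x q} := by
  obtain ⟨β, hβ, ρ, hρ, n₁, hn₁⟩ := exists_card_isGadgetFor_ge hm hη
  obtain ⟨K₀, hK₀⟩ := exists_nat_ge (4 / β)
  obtain ⟨K, hK⟩ : ∃ K, K = K₀ + h := ⟨_, rfl⟩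
  obtain ⟨L, hL⟩ : ∃ L, L = (h - 1) + 2 * m * K := ⟨_, rfl⟩
  have hL0 : 0 < L := by
    have hK0 : 0 < K := by omega
    have : 0 < 2 * m * K := by positivity
    omega
  have hLR : (0 : ℝ) < L := Nat.cast_pos.2 hL0
  obtain ⟨κ, hκ⟩ : ∃ κ, κ = min (min ρ (η / 2)) 1 / L := ⟨_, rfl⟩
  have hκ0 : 0 < κ := hκ ▸ by positivity
  have hκL : κ * L = min (min ρ (η / 2)) 1 := by rw [hκ, div_mul_cancel₀ _ hLR.ne']
  obtain ⟨n₂, hn₂⟩ := exists_nat_ge (2 / κ)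
  obtain ⟨n₃, hn₃⟩ : ∃ n₃ : ℕ, ∀ n : ℕ, n₃ ≤ n → Real.log n ≤ κ / 2 * n := by
    have := (Real.isLittleO_log_id_atTop.comp_tendsto tendsto_natCast_atTop_atTop).bound
      (half_pos hκ0)
    obtain ⟨n₃, hn₃⟩ := Filter.eventually_atTop.1 this
    refine ⟨n₃, fun n hn ↦ (le_abs_self _).trans ?_⟩
    simpa using hn₃ n hn
  refine ⟨κ / 2, half_pos hκ0, max (max n₁ n₂) (max n₃ 1), fun n hn G hdeg ↦ ?_⟩
  simp only [ge_iff_le, max_le_iff] at hn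
  obtain ⟨⟨hn1, hn2⟩, hn3, hn4⟩ := hn
  have hn0 : (0 : ℝ) < n := Nat.cast_pos.2 hn4
  have : Nonempty (Fin n) := ⟨⟨0, hn4⟩⟩
  have : Nonempty (Fin m) := ⟨⟨0, hm⟩⟩
  obtain ⟨M, hM⟩ : ∃ M, M = ⌊κ * n⌋₊ := ⟨_, rfl⟩
  have hMle : (M : ℝ) ≤ κ * n := hM ▸ Nat.floor_le (by positivity)
  have hMge : κ / 2 * n ≤ M := by
    have h1 : κ * n < M + 1 := hM ▸ Nat.lt_floor_add_one _
    have h2 : 2 ≤ κ * n := by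
      have := (div_le_iff₀ hκ0).1 (hn₂.trans (Nat.cast_le.2 hn2))
      linarith
    linarith
  have hLM : (L * M : ℝ) ≤ min (min ρ (η / 2)) 1 * n := by
    rw [← hκL]
    nlinarith
  have hLMρ : (L * M : ℝ) ≤ ρ * n :=
    hLM.trans (mul_le_mul_of_nonneg_right ((min_le_left _ _).trans (min_le_left _ _)) hn0.le)
  have hLMη : (L * M : ℝ) ≤ η / 2 * n :=
    hLM.trans (mul_le_mul_of_nonneg_right ((min_le_left _ _).trans (min_le_right _ _)) hn0.le)
  have hLMn : L * M ≤ n := by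
    have := hLM.trans (mul_le_mul_of_nonneg_right (min_le_right _ _) hn0.le)
    rw [one_mul] at this
    exact_mod_cast this
  have hLM' : L * M = (h - 1) * M + 2 * m * (K * M) := by rw [hL]; ring
  obtain ⟨Y, hY⟩ : ∃ Y : Finset (Fin n),
    Y = Finset.univ.filter fun v : Fin n ↦ (v : ℕ) < (h - 1) * M := ⟨_, rfl⟩
  have hYcard : #Y = (h - 1) * M := by
    rw [hY, Fin.card_filter_val_lt]
    exact min_eq_right (by omega)
  have hcount (x : Fin n) (U : Finset (Fin n)) (hU : #U ≤ ⌊ρ * n⌋₊) :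
      β * Fintype.card ((Fin m → Fin n) × (Fin m → Fin n)) ≤
        #{q : (Fin m → Fin n) × (Fin m → Fin n) |
          IsGadgetFor G x q ∧ Disjoint (gadgetSet q) U} :=
    hn₁ n hn1 G hdeg x U ((Nat.le_floor_iff (by positivity)).1 hU)
  have hβ1 : β ≤ 1 := by
    have h1 := hcount (Classical.arbitrary _) ∅ (by simp)
    have h2 : (0 : ℝ) < Fintype.card ((Fin m → Fin n) × (Fin m → Fin n)) :=
      Nat.cast_pos.2 Fintype.card_pos
    have h3 := h1.trans (Nat.cast_le.2 (Finset.card_le_univ _))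
    exact le_of_mul_le_mul_right (by linarith) h2
  obtain ⟨F, hFcard, hFdisj, hF, hFsum⟩ := exists_selection gadgetSet (IsGadgetFor G) hβ
    (fun q ↦ (Finset.univ_nonempty.image _).mono Finset.subset_union_left)
    gadgetSet_card_le (fun x U hU ↦ by convert hcount x U hU) Y (K * M) (by
      rw [hYcard, ← hLM']
      exact Nat.le_floor (by push_cast; exact hLMρ))
  refine ⟨M, K * M, Y, F, hMge, Nat.mul_le_mul_right _ (by omega), hYcard, hFcard, ?_, hFdisj, ?_,
    fun q hq ↦ (hF q hq).2, fun x ↦ ?_⟩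
  · rw [hYcard, ← hLM']
    exact_mod_cast hLMη
  · intro q hq y hy v hv
    have h1 := Finset.disjoint_left.1 (hF q hq).1 hv
    simp only [hY, Finset.mem_filter, Finset.mem_univ, true_and] at hy h1
    exact Fin.lt_def.2 (by omega)
  · refine le_of_half_pow_le (N := K * M) hn4 hβ1 ((hn₃ n hn3).trans hMge) ?_
      (le_trans (Finset.single_le_sum (f := fun x ↦ (1 / 2 : ℝ) ^ #{q ∈ F | IsGadgetFor G x q})
        (fun _ _ ↦ by positivity) (Finset.mem_univ x)) ?_)
    · have h1 : 4 ≤ β * K := by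
        rw [div_le_iff₀ hβ] at hK₀
        rw [hK]
        push_cast
        nlinarith [mul_nonneg hβ.le (Nat.cast_nonneg (α := ℝ) h)]
      push_cast
      rw [← mul_assoc]
      exact mul_le_mul_of_nonneg_right h1 (Nat.cast_nonneg M)
    · rwa [Fintype.card_fin] at hFsum

open Classical in
lemma exists_absorbing_set (hH : IsSplit H g r)
    (h₀ : ∀ a b : Fin h, (a : ℕ) = 0 → ¬ H.Adj a b) (hL : LastCut H) {η : ℝ} (hη : 0 < η) :
    ∃ γ : ℝ, 0 < γ ∧ ∃ n₀ : ℕ, ∀ n ≥ n₀, ∀ G : SimpleGraph (Fin n),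
      (∀ v, η * n ≤ odeg G v) → ∃ A : Finset (Fin n), #A ≤ η / 2 * n ∧
      ∀ X, Disjoint X A → #X ≤ γ * n → h ∣ #X + #A → HasPerfectTilingOn H G (X ∪ A) := by
  have hh : 0 < h := by have := hH.add_eq; have := hH.lt; omega
  have hh3 : h ≤ h ^ 3 := Nat.le_self_pow (by norm_num) h
  obtain ⟨γ, hγ, n₀, hn₀⟩ := exists_gadget_family (m := h ^ 3) (by positivity) hh hη
  refine ⟨γ, hγ, n₀, fun n hn G hdeg ↦ ?_⟩
  obtain ⟨M, N, Y, F, hM, hN, hYcard, hFcard, hsize, hFdisj, hYF, hF, hFgood⟩ := hn₀ n hn G hdeg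
  have hcards (q) (hq : q ∈ F) : CompletePair G (univ.image q.1) (univ.image q.2) ∧
      #(univ.image q.1) = h ^ 3 ∧ #(univ.image q.2) = h ^ 3 := by
    obtain ⟨x, h1, h2, h3, -⟩ := hF q hq
    refine ⟨h3, ?_, ?_⟩ <;> rw [Finset.card_image_of_injective _ (by assumption)] <;> simp
  have hFtil (q) (hq : q ∈ F) : HasPerfectTilingOn H G (gadgetSet q) := by
    obtain ⟨h1, h2, h3⟩ := hcards q hq
    exact h1.hasPerfectTilingOn_gadget hH h2 h3
  have hYdisj (q) (hq : q ∈ F) : Disjoint Y (gadgetSet q) :=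
    Finset.disjoint_left.2 fun v hvY hvq ↦ lt_irrefl _ (hYF q hq v hvY v hvq)
  have hYF' : Disjoint Y (F.biUnion gadgetSet) := (Finset.disjoint_biUnion_right _ _ _).2 hYdisj
  have hAcard : #(Y ∪ F.biUnion gadgetSet) ≤ #Y + 2 * h ^ 3 * N := by
    rw [← hFcard, mul_comm (2 * h ^ 3)]
    exact (Finset.card_union_le _ _).trans (Nat.add_le_add_left
      (Finset.card_biUnion_le_card_mul _ _ _ fun q _ ↦ gadgetSet_card_le q) _)
  refine ⟨Y ∪ F.biUnion gadgetSet, (Nat.cast_le.2 hAcard).trans hsize, fun X hXA hX hdvd ↦ ?_⟩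
  have hXM : #X ≤ M := by exact_mod_cast hX.trans hM
  have hhM : h * M = (h - 1) * M + M := by
    obtain ⟨t, rfl⟩ : ∃ t, h = t + 1 := ⟨h - 1, by omega⟩
    simp [add_mul]
  rw [Finset.disjoint_union_right] at hXA
  rw [← Finset.union_assoc]
  refine hasPerfectTilingOn_of_absorb (good := IsGadgetFor G) hh _ F X Y rfl hFdisj hFtil ?_
    hXA.1 ?_ (fun x _ ↦ hXM.trans (hFgood x)) ?_ ?_ ?_ (by omega)
  · intro q hq x hxq hx Z hZ hZcard hxZ
    obtain ⟨h1, h2, h3⟩ := hcards q hq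
    exact h1.hasPerfectTilingOn_absorb hH h₀ h2 h3 hZcard (fun z hz ↦ hYF q hq z (hZ hz)) hxq hxZ
      (h1.completesTo hH h₀ hL (by omega) (by omega) hx.2.2.2)
  · intro q hq
    rw [Finset.disjoint_union_left]
    exact ⟨(Finset.disjoint_biUnion_right _ _ _).1 hXA.2 q hq, hYdisj q hq⟩
  · intro y hy q hq
    obtain ⟨x, h1, h2, h3, -⟩ := hF q hq
    exact ⟨h1, h2, h3, .inr (.inr (.inr fun a ha ↦ hYF q hq y hy a
      (Finset.mem_union_left _ ha)))⟩
  · rw [hYcard]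
    exact Nat.mul_le_mul_left _ hXM
  · rw [Finset.card_union_of_disjoint hYF', ← add_assoc] at hdvd
    exact (Nat.dvd_add_left (hasPerfectTilingOn_biUnion F hFdisj hFtil).dvd_card).1 hdvd

open Classical in
/-- Ordered graphs with a split, an isolated first vertex and a cut for the last vertex. -/
lemma exists_hasPerfectTiling (hH : IsSplit H g r) (hg : 0 < g)
    (h₀ : ∀ a b : Fin h, (a : ℕ) = 0 → ¬ H.Adj a b) (hL : LastCut H) {η : ℝ} (hη : 0 < η) :
    ∃ n₀ : ℕ, ∀ n : ℕ, n₀ ≤ n → h ∣ n → ∀ G : SimpleGraph (Fin n),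
      (∀ v, ((g : ℝ) / h + η) * n ≤ odeg G v) → HasPerfectTiling H G := by
  obtain ⟨γ, hγ, n₁, hn₁⟩ := exists_absorbing_set hH h₀ hL hη
  obtain ⟨n₂, hn₂⟩ := exists_tiling_sdiff_card_le hH hg (half_pos hη) hγ
  refine ⟨max n₁ n₂, fun n hn hdvd G hdeg ↦ ?_⟩
  have hgh : (0 : ℝ) ≤ (g : ℝ) / h := by positivity
  obtain ⟨A, hA, habs⟩ := hn₁ n ((le_max_left _ _).trans hn) G fun v ↦
    (mul_le_mul_of_nonneg_right (by linarith) (Nat.cast_nonneg n)).trans (hdeg v)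
  obtain ⟨X, hXA, hX, htil⟩ := hn₂ n ((le_max_right _ _).trans hn) G Aᶜ (by
    intro v _
    have h1 : (#(Aᶜ) : ℝ) ≤ n :=
      Nat.cast_le.2 ((Finset.card_le_univ _).trans_eq (Fintype.card_fin n))
    have h2 : odeg G v ≤ #{w ∈ Aᶜ | G.Adj v w} + #A := by
      rw [odeg_eq_card]
      refine (Finset.card_le_card fun w hw ↦ ?_).trans (Finset.card_union_le ..)
      simp only [Finset.mem_filter, Finset.mem_univ, true_and, Finset.mem_union,
        Finset.mem_compl] at hw ⊢
      tauto
    have h3 : (odeg G v : ℝ) ≤ #{w ∈ Aᶜ | G.Adj v w} + #A := by exact_mod_cast h2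
    have h4 := hdeg v
    have h5 : ((g : ℝ) / h + η / 2) * #(Aᶜ) ≤ ((g : ℝ) / h + η / 2) * n :=
      mul_le_mul_of_nonneg_left h1 (by positivity)
    linarith)
  have hXA' : Disjoint X A := Finset.disjoint_of_subset_left hXA disjoint_compl_left
  have hdisj : Disjoint (X ∪ A) (Aᶜ \ X) := by
    rw [Finset.disjoint_union_left]
    exact ⟨Finset.disjoint_sdiff, Finset.disjoint_of_subset_right Finset.sdiff_subset
      disjoint_compl_right⟩
  have huniv : X ∪ A ∪ (Aᶜ \ X) = univ := by
    ext x
    simp only [Finset.mem_union, Finset.mem_sdiff, Finset.mem_compl, Finset.mem_univ, iff_true]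
    tauto
  have hcard : #X + #A + #(Aᶜ \ X) = n := by
    rw [← Finset.card_union_of_disjoint hXA', ← Finset.card_union_of_disjoint hdisj, huniv]
    simp
  unfold HasPerfectTiling
  rw [← huniv]
  refine (habs X hXA' hX ?_).union htil hdisj
  rw [← hcard] at hdvd
  exact (Nat.dvd_add_left htil.dvd_card).1 hdvd

end AbsorbingSet

section Structure

variable {h n g r : ℕ} {H : SimpleGraph (Fin h)} {G : SimpleGraph (Fin n)}

lemma exists_lt_adj_of_intervalChi (hchi : intervalChi H = 2) : ∃ a b, a < b ∧ H.Adj a b := by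
  by_contra! hcon
  have h1 : HasIntervalColoring H 1 := by
    refine ⟨fun _ ↦ 0, fun _ _ _ ↦ le_rfl, fun i j hij ↦ ?_⟩
    rcases lt_or_gt_of_ne hij.ne with hlt | hlt
    exacts [absurd hij (hcon i j hlt), absurd hij.symm (hcon j i hlt)]
  have h2 : intervalChi H ≤ 1 := Nat.sInf_le h1
  omega

lemma alphaPlus_one_spec (H : SimpleGraph (Fin h)) : alphaPlus H 1 ≤ h ∧
    ∀ a b : Fin h, (a : ℕ) < alphaPlus H 1 → (b : ℕ) < alphaPlus H 1 → ¬ H.Adj a b := by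
  have h1 : alphaPlus H 1 ∈ {k | k ≤ h ∧ ∀ a b : Fin h,
      alphaPlus H 0 + 1 ≤ (a : ℕ) + 1 → (a : ℕ) + 1 ≤ k →
      alphaPlus H 0 + 1 ≤ (b : ℕ) + 1 → (b : ℕ) + 1 ≤ k → ¬ H.Adj a b} := by
    rw [alphaPlus]
    exact Nat.sSup_mem ⟨0, by simp⟩ ⟨h, fun k hk ↦ hk.1⟩
  exact ⟨h1.1, fun a b ha hb ↦ h1.2 a b (by simp [alphaPlus]) ha (by simp [alphaPlus]) hb⟩

lemma le_alphaPlus_one {k : ℕ} (hk : k ≤ h)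
    (hkH : ∀ a b : Fin h, (a : ℕ) + 1 ≤ k → (b : ℕ) + 1 ≤ k → ¬ H.Adj a b) :
    k ≤ alphaPlus H 1 := by
  rw [alphaPlus]
  exact le_csSup ⟨h, fun k hk ↦ hk.1⟩ ⟨hk, fun a b _ ha _ hb ↦ hkH a b ha hb⟩

lemma alphaMinus_one_spec (H : SimpleGraph (Fin h)) : 1 ≤ alphaMinus H 1 ∧
    ∀ a b : Fin h, alphaMinus H 1 ≤ (a : ℕ) + 1 → alphaMinus H 1 ≤ (b : ℕ) + 1 →
      ¬ H.Adj a b := by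
  have h1 : alphaMinus H 1 ∈ {k | 1 ≤ k ∧ ∀ a b : Fin h,
      k ≤ (a : ℕ) + 1 → (a : ℕ) + 1 ≤ alphaMinus H 0 - 1 →
      k ≤ (b : ℕ) + 1 → (b : ℕ) + 1 ≤ alphaMinus H 0 - 1 → ¬ H.Adj a b} := by
    rw [alphaMinus]
    exact Nat.sInf_mem ⟨h + 1, by omega, fun a _ ha ↦ by omega⟩
  refine ⟨h1.1, fun a b ha hb ↦ h1.2 a b ha ?_ hb ?_⟩ <;> simp only [alphaMinus] <;> omega

lemma alphaMinus_one_le {k : ℕ} (hk : 1 ≤ k)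
    (hkH : ∀ a b : Fin h, k ≤ (a : ℕ) + 1 → k ≤ (b : ℕ) + 1 → ¬ H.Adj a b) :
    alphaMinus H 1 ≤ k := by
  rw [alphaMinus]
  exact Nat.sInf_le ⟨hk, fun a b ha _ hb _ ↦ hkH a b ha hb⟩

lemma PropertyA.exists_isSplit (hA : PropertyA H) (hchi : intervalChi H = 2) :
    ∃ g r, IsSplit H g r ∧ 0 < g ∧ 1 - alphaStar2 H = (g : ℝ) / h := by
  obtain ⟨a₀, b₀, hab₀, hadj₀⟩ := exists_lt_adj_of_intervalChi hchi
  have hh : 2 ≤ h := by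
    have := Fin.lt_def.1 hab₀
    omega
  obtain ⟨hP, hPH⟩ := alphaPlus_one_spec H
  obtain ⟨hQ, hQH⟩ := alphaMinus_one_spec H
  have hPA : h / 2 + 1 ≤ alphaPlus H 1 := le_alphaPlus_one (by omega) hA.1
  have hQA : alphaMinus H 1 ≤ (h + 1) / 2 := alphaMinus_one_le (by omega) hA.2
  have hstar : alphaStar2 H = (min (alphaPlus H 1) (h + 1 - alphaMinus H 1) : ℕ) / (h : ℝ) := by
    rw [alphaStar2, Nat.cast_min, ← min_div_div_right (Nat.cast_nonneg h),
      Nat.cast_sub (by omega)]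
    push_cast
    ring_nf
  obtain ⟨r, hr⟩ : ∃ r, r = min (alphaPlus H 1) (h + 1 - alphaMinus H 1) := ⟨_, rfl⟩
  have hcross (a b : Fin h) (hab : a < b) (hadj : H.Adj a b) : (a : ℕ) < h - r ∧ r ≤ (b : ℕ) := by
    have h1 := Fin.lt_def.1 hab
    have h2 : ¬ (b : ℕ) < alphaPlus H 1 := fun hb ↦ hPH a b (by omega) hb hadj
    have h3 : ¬ alphaMinus H 1 ≤ (a : ℕ) + 1 := fun ha ↦ hQH a b ha (by omega) hadj
    omega
  have h1 := hcross a₀ b₀ hab₀ hadj₀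
  refine ⟨h - r, r, ⟨by omega, by omega, hcross⟩, by omega, ?_⟩
  rw [hstar, ← hr, Nat.cast_sub (by omega)]
  field_simp

lemma IsSplit.first_or_last_isolated (hH : IsSplit H g r) (hchi : intervalChi H = 2)
    (hB : ¬ PropertyB H) : (∀ a b : Fin h, (a : ℕ) = 0 → ¬ H.Adj a b) ∨
      ∀ a b : Fin h, (a : ℕ) + 1 = h → ¬ H.Adj a b := by
  obtain ⟨a₀, b₀, hab₀, hadj₀⟩ := exists_lt_adj_of_intervalChi hchi
  have hadd := hH.add_eq
  have hlt := hH.lt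
  simp only [PropertyB, not_forall] at hB
  obtain ⟨i, hi, hih, hB⟩ := hB
  have hcross (a b : Fin h) (hab : a < b) (hadj : H.Adj a b) : i ≤ (a : ℕ) ∨ (b : ℕ) < i := by
    by_contra! hcon
    exact hB ⟨a, b, hadj, by omega, by omega⟩
  have h1 := hcross a₀ b₀ hab₀ hadj₀
  have h2 := hH.edge a₀ b₀ hab₀ hadj₀
  rcases h1 with h1 | h1
  · refine .inl fun a b ha hadj ↦ ?_
    have hab : a < b := lt_of_le_of_ne (Fin.le_def.2 (by omega)) hadj.ne
    have h3 := hcross a b hab hadj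
    have h4 := hH.edge a b hab hadj
    omega
  · refine .inr fun a b ha hadj ↦ ?_
    have hab : b < a := lt_of_le_of_ne (Fin.le_def.2 (by omega)) hadj.ne'
    have h3 := hcross b a hab hadj.symm
    have h4 := hH.edge b a hab hadj.symm
    omega

lemma IsSplit.lastCut (hH : IsSplit H g r) (hC : ¬ PropertyCLast H) : LastCut H := by
  have hadd := hH.add_eq
  have hlt := hH.lt
  by_cases hne : ∃ a b : Fin h, H.Adj a b ∧ (b : ℕ) + 1 = h
  · obtain ⟨a, b, hadj, ha, hb⟩ :
        ∃ a b : Fin h, H.Adj a b ∧ (a : ℕ) + 1 = sOG H ∧ (b : ℕ) + 1 = h := by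
      obtain ⟨a, b, hadj, hb⟩ := hne
      exact Nat.sInf_mem (s := {k | ∃ a b : Fin h, H.Adj a b ∧ (a : ℕ) + 1 = k ∧ (b : ℕ) + 1 = h})
        ⟨_, a, b, hadj, rfl, hb⟩
    have hab := hH.edge a b (lt_of_le_of_ne (Fin.le_def.2 (by omega)) hadj.ne) hadj
    refine ⟨a, by omega, fun c d hcd hadj' ↦ ⟨fun hd ↦ ?_, fun hd ↦ ?_⟩⟩
    · have h1 := Fin.lt_def.1 hcd
      have h2 := hH.edge c d hcd hadj'
      have h3 : ¬ (a : ℕ) ≤ (c : ℕ) := fun h3 ↦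
        hC ⟨by omega, c, d, hadj', by omega, by omega, by omega, by omega⟩
      omega
    · have h1 : sOG H ≤ (c : ℕ) + 1 := Nat.sInf_le ⟨c, d, hadj', rfl, hd⟩
      omega
  · push Not at hne
    exact ⟨g, by omega, fun a b hab hadj ↦
      ⟨fun _ ↦ by have := hH.edge a b hab hadj; omega, fun hb ↦ absurd hb (hne a b hadj)⟩⟩

lemma IsSplit.comap_rev (hH : IsSplit H g r) : IsSplit (H.comap Fin.rev) g r := by
  have hadd := hH.add_eq
  refine ⟨hadd, hH.lt, fun a b hab hadj ↦ ?_⟩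
  have h1 := hH.edge b.rev a.rev (Fin.rev_lt_rev.2 hab) hadj.symm
  rw [Fin.val_rev, Fin.val_rev] at h1
  omega

lemma IsSplit.lastCut_comap_rev (hH : IsSplit H g r) (hC : ¬ PropertyCFirst H) :
    LastCut (H.comap Fin.rev) := by
  have hadd := hH.add_eq
  have hlt := hH.lt
  by_cases hne : ∃ a b : Fin h, H.Adj a b ∧ (a : ℕ) + 1 = 1
  · have hbdd : BddAbove {k | ∃ a b : Fin h, H.Adj a b ∧ (a : ℕ) + 1 = 1 ∧ (b : ℕ) + 1 = k} :=
      ⟨h, by rintro k ⟨a, b, -, -, hb⟩; omega⟩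
    have hl : lOG H = sSup {k | ∃ a b : Fin h, H.Adj a b ∧ (a : ℕ) + 1 = 1 ∧ (b : ℕ) + 1 = k} :=
      if_pos hne
    obtain ⟨a, b, hadj, ha, hb⟩ :
        ∃ a b : Fin h, H.Adj a b ∧ (a : ℕ) + 1 = 1 ∧ (b : ℕ) + 1 = lOG H := by
      obtain ⟨a, b, hadj, ha⟩ := hne
      rw [hl]
      exact Nat.sSup_mem (s := {k | ∃ a b : Fin h, H.Adj a b ∧ (a : ℕ) + 1 = 1 ∧ (b : ℕ) + 1 = k})
        ⟨_, a, b, hadj, ha, rfl⟩ hbdd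
    have hab := hH.edge a b (lt_of_le_of_ne (Fin.le_def.2 (by omega)) hadj.ne) hadj
    refine ⟨h - lOG H, by omega, fun c d hcd hadj' ↦ ?_⟩
    have hadj'' : H.Adj d.rev c.rev := hadj'.symm
    have h2 := hH.edge _ _ (Fin.rev_lt_rev.2 hcd) hadj''
    have h1 := Fin.lt_def.1 hcd
    have hc := Fin.val_rev c
    have hd := Fin.val_rev d
    refine ⟨fun hd' ↦ ?_, fun hd' ↦ ?_⟩
    · have h3 : ¬ (c.rev : ℕ) + 1 ≤ lOG H := fun h3 ↦
        hC ⟨by omega, d.rev, c.rev, hadj'', by omega, by omega, by omega, by omega⟩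
      omega
    · have h3 : (c.rev : ℕ) + 1 ≤ lOG H := by
        rw [hl]
        exact le_csSup hbdd ⟨d.rev, c.rev, hadj'', by omega, rfl⟩
      omega
  · push Not at hne
    refine ⟨g, by omega, fun a b hab hadj ↦
      ⟨fun _ ↦ by have := hH.comap_rev.edge a b hab hadj; omega, fun hb ↦ ?_⟩⟩
    have hb' := Fin.val_rev b
    exact absurd (by omega) (hne b.rev a.rev hadj.symm)

lemma IsCopySet.of_comap_rev {T : Finset (Fin n)}
    (hT : IsCopySet (H.comap Fin.rev) (G.comap Fin.rev) T) : IsCopySet H G (T.image Fin.rev) := by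
  obtain ⟨φ, ⟨hφ, hadj⟩, rfl⟩ := hT
  refine ⟨fun i ↦ (φ i.rev).rev, ⟨fun i j hij ↦ Fin.rev_lt_rev.2 (hφ (Fin.rev_lt_rev.2 hij)),
    fun i j hij ↦ hadj i.rev j.rev (by simpa using hij)⟩, ?_⟩
  ext v
  simp only [Finset.mem_image, Finset.mem_univ, true_and, exists_exists_eq_and]
  exact ⟨fun ⟨i, hi⟩ ↦ ⟨i.rev, hi⟩, fun ⟨i, hi⟩ ↦ ⟨i.rev, by rwa [Fin.rev_rev]⟩⟩

lemma HasPerfectTiling.of_comap_rev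
    (hHG : HasPerfectTiling (H.comap Fin.rev) (G.comap Fin.rev)) : HasPerfectTiling H G := by
  obtain ⟨𝒯, h₁, h₂, h₃⟩ := hHG
  refine ⟨𝒯.image (Finset.image Fin.rev), ?_, ?_, ?_⟩
  · intro T hT
    obtain ⟨T', hT', rfl⟩ := Finset.mem_image.1 hT
    exact (h₁ T' hT').of_comap_rev
  · intro A hA B hB hAB
    obtain ⟨A', hA', rfl⟩ := Finset.mem_image.1 hA
    obtain ⟨B', hB', rfl⟩ := Finset.mem_image.1 hB
    exact (Finset.disjoint_image Fin.rev_injective).2 (h₂ hA' hB' fun h ↦ hAB (h ▸ rfl))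
  · rw [Finset.eq_univ_iff_forall] at h₃ ⊢
    intro v
    obtain ⟨T, hT, hv⟩ := Finset.mem_biUnion.1 (h₃ v.rev)
    exact Finset.mem_biUnion.2 ⟨_, Finset.mem_image_of_mem _ hT,
      Finset.mem_image.2 ⟨_, hv, Fin.rev_rev v⟩⟩

lemma odeg_comap_rev (v : Fin n) : odeg (G.comap Fin.rev) v = odeg G v.rev := by
  have h1 : (G.comap Fin.rev).neighborSet v = Fin.rev '' G.neighborSet v.rev := by
    ext w
    simp only [SimpleGraph.mem_neighborSet, SimpleGraph.comap_adj, Set.mem_image]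
    exact ⟨fun hw ↦ ⟨w.rev, hw, Fin.rev_rev w⟩, by rintro ⟨u, hu, rfl⟩; rwa [Fin.rev_rev]⟩
  rw [odeg, h1, Set.ncard_image_of_injective _ Fin.rev_injective, odeg]

end Structure

theorem perfect_tiling_case_iv (h : ℕ) (H : SimpleGraph (Fin h))
    (hchi : intervalChi H = 2)
    (hA : PropertyA H) (hB : ¬ PropertyB H)
    (hC1 : ¬ PropertyCFirst H) (hCh : ¬ PropertyCLast H)
    (η : ℝ) (hη : 0 < η) :
    ∃ n₀ : ℕ, ∀ n : ℕ, n₀ ≤ n → h ∣ n → ∀ G : SimpleGraph (Fin n),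
      (∀ v : Fin n, (1 - alphaStar2 H + η) * n ≤ (odeg G v : ℝ)) →
      HasPerfectTiling H G := by
  obtain ⟨g, r, hH, hg, hstar⟩ := hA.exists_isSplit hchi
  rw [hstar]
  rcases hH.first_or_last_isolated hchi hB with h₀ | h₀
  · exact exists_hasPerfectTiling hH hg h₀ (hH.lastCut hCh) hη
  · obtain ⟨n₀, hn₀⟩ := exists_hasPerfectTiling hH.comap_rev hg
      (fun a b ha ↦ h₀ a.rev b.rev (by rw [Fin.val_rev]; omega)) (hH.lastCut_comap_rev hC1) hη
    refine ⟨n₀, fun n hn hdvd G hdeg ↦ HasPerfectTiling.of_comap_rev (hn₀ n hn hdvd _ fun v ↦ ?_)⟩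
    rw [odeg_comap_rev]
    exact hdeg v.rev
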